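/- arXiv:1906.06625 — 4 statements merged into one kernel-verified Lean document; each statement's English description precedes it below -/
import Mathlib

section
/- Let 0 < α < 1 and let b, η, (a_k), (ε_k), f₁, f₂, f = f₁f₂ and u(t) = ∫_0^t f(z)(t−z)^{α−1} dz be as in the context. Then for every integer N ≥ 1 such that I_α[1 − ε_N/a_{2N+1}, 1] < η/4 and a_{2N}(a_1 − 1) ≥ 2, one has u(a_{2N+2}) − u(a_{2N+1}) ≤ −η/4. Consequently liminf_{t→∞} u(t) − limsup_{t→∞} u(t) ≤ −η/4. -/
open MeasureTheory Filter

/-- The integrand `s^(-α) (1-s)^(α-1)` of the Beta integral `B(1-α, α)`. -/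
noncomputable def betaWeight (α s : ℝ) : ℝ := s ^ (-α) * (1 - s) ^ (α - 1)

section BetaWeight

variable {α : ℝ}

lemma betaWeight_nonneg {s : ℝ} (hs : s ∈ Set.Icc (0 : ℝ) 1) : 0 ≤ betaWeight α s :=
  mul_nonneg (Real.rpow_nonneg hs.1 _) (Real.rpow_nonneg (sub_nonneg.2 hs.2) _)

lemma betaWeight_pos {s : ℝ} (hs : s ∈ Set.Ioo (0 : ℝ) 1) : 0 < betaWeight α s :=
  mul_pos (Real.rpow_pos_of_pos hs.1 _) (Real.rpow_pos_of_pos (sub_pos.2 hs.2) _)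

lemma intervalIntegrable_betaWeight (hα0 : 0 < α) (hα1 : α < 1) {x y : ℝ}
    (hx : x ∈ Set.Icc (0 : ℝ) 1) (hy : y ∈ Set.Icc (0 : ℝ) 1) :
    IntervalIntegrable (betaWeight α) volume x y := by
  have h := Complex.betaIntegral_convergent (u := ((1 - α : ℝ) : ℂ)) (v := ((α : ℝ) : ℂ))
    (by simpa using hα1) (by simpa using hα0)
  have h01 : IntervalIntegrable (betaWeight α) volume 0 1 := by
    refine h.norm.congr_uIoo ?_
    intro s hs
    rw [Set.uIoo_of_le zero_le_one] at hs
    have h1 : (1 : ℂ) - (s : ℂ) = ((1 - s : ℝ) : ℂ) := by push_cast; rfl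
    have h1s : 0 < 1 - s := sub_pos.2 hs.2
    simp only [norm_mul, betaWeight]
    rw [h1, Complex.norm_cpow_eq_rpow_re_of_pos hs.1, Complex.norm_cpow_eq_rpow_re_of_pos h1s]
    simp
  refine IntervalIntegrable.mono_set h01 ?_
  rw [Set.uIcc_of_le (zero_le_one' ℝ)]
  exact Set.uIcc_subset_Icc hx hy

lemma intervalIntegrable_betaWeight_mul (hα0 : 0 < α) (hα1 : α < 1) {x y : ℝ}
    (hx : x ∈ Set.Icc (0 : ℝ) 1) (hy : y ∈ Set.Icc (0 : ℝ) 1) {F : ℝ → ℝ} (hF : Measurable F)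
    (hF01 : ∀ s, F s ∈ Set.Icc (0 : ℝ) 1) :
    IntervalIntegrable (fun s ↦ betaWeight α s * F s) volume x y := by
  have h := intervalIntegrable_betaWeight hα0 hα1 hx hy
  rw [intervalIntegrable_iff] at h ⊢
  refine Integrable.mul_bdd (c := 1) h hF.aestronglyMeasurable (ae_of_all _ fun s ↦ ?_)
  rw [Real.norm_of_nonneg (hF01 s).1]
  exact (hF01 s).2

lemma integral_betaWeight_mul_nonneg {x y : ℝ} (hx : 0 ≤ x) (hxy : x ≤ y) (hy : y ≤ 1)
    {F : ℝ → ℝ} (hF01 : ∀ s, F s ∈ Set.Icc (0 : ℝ) 1) :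
    0 ≤ ∫ s in x..y, betaWeight α s * F s :=
  intervalIntegral.integral_nonneg hxy fun s hs ↦
    mul_nonneg (betaWeight_nonneg ⟨hx.trans hs.1, hs.2.trans hy⟩) (hF01 s).1

lemma integral_betaWeight_mul_le (hα0 : 0 < α) (hα1 : α < 1) {x y : ℝ} (hx : 0 ≤ x)
    (hxy : x ≤ y) (hy : y ≤ 1) {F : ℝ → ℝ} (hF : Measurable F)
    (hF01 : ∀ s, F s ∈ Set.Icc (0 : ℝ) 1) :
    ∫ s in x..y, betaWeight α s * F s ≤ ∫ s in x..y, betaWeight α s := by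
  have hx' : x ∈ Set.Icc (0 : ℝ) 1 := ⟨hx, hxy.trans hy⟩
  have hy' : y ∈ Set.Icc (0 : ℝ) 1 := ⟨hx.trans hxy, hy⟩
  refine intervalIntegral.integral_mono_on hxy
    (intervalIntegrable_betaWeight_mul hα0 hα1 hx' hy' hF hF01)
    (intervalIntegrable_betaWeight hα0 hα1 hx' hy') fun s hs ↦ ?_
  exact mul_le_of_le_one_right (betaWeight_nonneg ⟨hx.trans hs.1, hs.2.trans hy⟩) (hF01 s).2

/-- Lower bound for an average that equals the full weight on `[x, y]`. -/
lemma integral_betaWeight_le_integral_mul (hα0 : 0 < α) (hα1 : α < 1) {x y : ℝ} (hx : 0 ≤ x)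
    (hxy : x ≤ y) (hy : y ≤ 1) {F : ℝ → ℝ} (hF : Measurable F)
    (hF01 : ∀ s, F s ∈ Set.Icc (0 : ℝ) 1) (hone : ∀ s ∈ Set.Icc x y, F s = 1) :
    ∫ s in x..y, betaWeight α s ≤ ∫ s in (0 : ℝ)..1, betaWeight α s * F s := by
  have hx' : x ∈ Set.Icc (0 : ℝ) 1 := ⟨hx, hxy.trans hy⟩
  have hy' : y ∈ Set.Icc (0 : ℝ) 1 := ⟨hx.trans hxy, hy⟩
  have h0 : (0 : ℝ) ∈ Set.Icc (0 : ℝ) 1 := ⟨le_rfl, zero_le_one⟩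
  have h1 : (1 : ℝ) ∈ Set.Icc (0 : ℝ) 1 := ⟨zero_le_one, le_rfl⟩
  have hint {p q : ℝ} (hp : p ∈ Set.Icc (0 : ℝ) 1) (hq : q ∈ Set.Icc (0 : ℝ) 1) :=
    intervalIntegrable_betaWeight_mul hα0 hα1 hp hq hF hF01
  have heq : ∫ s in x..y, betaWeight α s = ∫ s in x..y, betaWeight α s * F s := by
    refine intervalIntegral.integral_congr fun s hs ↦ ?_
    rw [Set.uIcc_of_le hxy] at hs
    simp [hone s hs]
  rw [heq, ← intervalIntegral.integral_add_adjacent_intervals (hint h0 hx') (hint hx' h1),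
    ← intervalIntegral.integral_add_adjacent_intervals (hint hx' hy') (hint hy' h1)]
  have e1 := integral_betaWeight_mul_nonneg (α := α) le_rfl hx hx'.2 hF01
  have e2 := integral_betaWeight_mul_nonneg (α := α) hy'.1 hy le_rfl hF01
  linarith

/-- Upper bound for an average that vanishes on `[p, q]` and on `[x, 1]`. -/
lemma integral_betaWeight_mul_le_sub (hα0 : 0 < α) (hα1 : α < 1) {p q x : ℝ} (hp : 0 ≤ p)
    (hpq : p ≤ q) (hqx : q ≤ x) (hx : x ≤ 1) {F : ℝ → ℝ} (hF : Measurable F)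
    (hF01 : ∀ s, F s ∈ Set.Icc (0 : ℝ) 1) (hzero : ∀ s ∈ Set.Icc p q, F s = 0)
    (hzero' : ∀ s ∈ Set.Icc x 1, F s = 0) :
    ∫ s in (0 : ℝ)..1, betaWeight α s * F s
      ≤ (∫ s in (0 : ℝ)..x, betaWeight α s) - ∫ s in p..q, betaWeight α s := by
  have hp' : p ∈ Set.Icc (0 : ℝ) 1 := ⟨hp, by linarith⟩
  have hq' : q ∈ Set.Icc (0 : ℝ) 1 := ⟨by linarith, by linarith⟩
  have hx' : x ∈ Set.Icc (0 : ℝ) 1 := ⟨by linarith, hx⟩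
  have h0 : (0 : ℝ) ∈ Set.Icc (0 : ℝ) 1 := ⟨le_rfl, zero_le_one⟩
  have h1 : (1 : ℝ) ∈ Set.Icc (0 : ℝ) 1 := ⟨zero_le_one, le_rfl⟩
  have hint {c d : ℝ} (hc : c ∈ Set.Icc (0 : ℝ) 1) (hd : d ∈ Set.Icc (0 : ℝ) 1) :=
    intervalIntegrable_betaWeight_mul hα0 hα1 hc hd hF hF01
  have hint' {c d : ℝ} (hc : c ∈ Set.Icc (0 : ℝ) 1) (hd : d ∈ Set.Icc (0 : ℝ) 1) :=
    intervalIntegrable_betaWeight hα0 hα1 hc hd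
  have hvanish {c d : ℝ} (hcd : c ≤ d) (h : ∀ s ∈ Set.Icc c d, F s = 0) :
      ∫ s in c..d, betaWeight α s * F s = 0 := by
    rw [← intervalIntegral.integral_zero (a := c) (b := d) (μ := volume) (E := ℝ)]
    refine intervalIntegral.integral_congr fun s hs ↦ ?_
    rw [Set.uIcc_of_le hcd] at hs
    simp [h s hs]
  rw [← intervalIntegral.integral_add_adjacent_intervals (hint h0 hx') (hint hx' h1),
    ← intervalIntegral.integral_add_adjacent_intervals (hint h0 hp') (hint hp' hx'),
    ← intervalIntegral.integral_add_adjacent_intervals (hint hp' hq') (hint hq' hx'),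
    ← intervalIntegral.integral_add_adjacent_intervals (hint' h0 hp') (hint' hp' hx'),
    ← intervalIntegral.integral_add_adjacent_intervals (hint' hp' hq') (hint' hq' hx'),
    hvanish hpq hzero, hvanish hx hzero']
  have e1 := integral_betaWeight_mul_le hα0 hα1 le_rfl hp hp'.2 hF hF01
  have e2 := integral_betaWeight_mul_le hα0 hα1 hq'.1 hqx hx hF hF01
  linarith

lemma betaWeight_le (hα0 : 0 < α) (hα1 : α < 1) {s T : ℝ} (hT : 0 < T) (h : 1 ≤ T * s)
    (h' : 1 ≤ T * (1 - s)) : betaWeight α s ≤ T := by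
  have hinv : (0 : ℝ) < T⁻¹ := inv_pos.2 hT
  have hs : T⁻¹ ≤ s := by rwa [inv_le_iff_one_le_mul₀' hT]
  have hs' : T⁻¹ ≤ 1 - s := by rwa [inv_le_iff_one_le_mul₀' hT]
  calc betaWeight α s ≤ T⁻¹ ^ (-α) * T⁻¹ ^ (α - 1) :=
        mul_le_mul (Real.rpow_le_rpow_of_nonpos hinv hs (by linarith))
          (Real.rpow_le_rpow_of_nonpos hinv hs' (by linarith))
          (Real.rpow_nonneg (by linarith) _) (Real.rpow_nonneg hinv.le _)
    _ = T := by
        rw [← Real.rpow_add hinv, show -α + (α - 1) = -1 by ring, Real.rpow_neg_one, inv_inv]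

lemma betaWeight_le_inv_mul (hα0 : 0 < α) (hα1 : α < 1) {s p q : ℝ} (hp : 0 < p) (hp1 : p ≤ 1)
    (hq : q < 1) (hps : p ≤ s) (hsq : s ≤ q) :
    betaWeight α s ≤ p⁻¹ * (1 - q)⁻¹ := by
  have hq' : 0 < 1 - q := by linarith
  refine mul_le_mul ?_ ?_ (Real.rpow_nonneg (by linarith) _) (inv_nonneg.2 hp.le)
  · calc s ^ (-α) ≤ p ^ (-α) := Real.rpow_le_rpow_of_nonpos hp hps (by linarith)
      _ ≤ p ^ (-1 : ℝ) := Real.rpow_le_rpow_of_exponent_ge hp hp1 (by linarith)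
      _ = p⁻¹ := Real.rpow_neg_one p
  · calc (1 - s) ^ (α - 1) ≤ (1 - q) ^ (α - 1) :=
          Real.rpow_le_rpow_of_nonpos hq' (by linarith) (by linarith)
      _ ≤ (1 - q) ^ (-1 : ℝ) := Real.rpow_le_rpow_of_exponent_ge hq' (by linarith) (by linarith)
      _ = (1 - q)⁻¹ := Real.rpow_neg_one _

lemma integral_betaWeight_le_mul (hα0 : 0 < α) (hα1 : α < 1) {x y C : ℝ} (hx : 0 ≤ x)
    (hxy : x ≤ y) (hy : y ≤ 1) (h : ∀ s ∈ Set.Icc x y, betaWeight α s ≤ C) :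
    ∫ s in x..y, betaWeight α s ≤ C * (y - x) := by
  have := intervalIntegral.integral_mono_on hxy
    (intervalIntegrable_betaWeight hα0 hα1 ⟨hx, hxy.trans hy⟩ ⟨hx.trans hxy, hy⟩)
    (intervalIntegrable_const (c := C)) h
  simpa [mul_comm] using this

/-- Rescaling `[0, t]` to `[0, 1]` removes all powers of `t`. -/
lemma integral_rpow_mul_eq_integral_betaWeight {t : ℝ} (ht : 0 < t) (F : ℝ → ℝ) :
    ∫ z in (0 : ℝ)..t, z ^ (-α) * F z * (t - z) ^ (α - 1)
      = ∫ s in (0 : ℝ)..1, betaWeight α s * F (t * s) := by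
  have h := intervalIntegral.mul_integral_comp_mul_left (a := 0) (b := 1) (c := t)
    (f := fun z ↦ z ^ (-α) * F z * (t - z) ^ (α - 1))
  rw [mul_zero, mul_one] at h
  rw [← h, ← intervalIntegral.integral_const_mul]
  refine intervalIntegral.integral_congr fun s hs ↦ ?_
  rw [Set.uIcc_of_le zero_le_one] at hs
  have h1 : t - t * s = t * (1 - s) := by ring
  have h2 : t * (t ^ (-α) * t ^ (α - 1)) = 1 := by
    rw [← Real.rpow_add ht, show -α + (α - 1) = -1 by ring, Real.rpow_neg_one,
      mul_inv_cancel₀ ht.ne']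
  simp only [betaWeight]
  rw [h1, Real.mul_rpow ht.le hs.1, Real.mul_rpow ht.le (sub_nonneg.2 hs.2)]
  linear_combination (s ^ (-α) * (1 - s) ^ (α - 1) * F (t * s)) * h2

lemma tendsto_integral_betaWeight_one (hα0 : 0 < α) (hα1 : α < 1) {δ : ℕ → ℝ}
    (hδ : ∀ n, δ n ∈ Set.Icc (0 : ℝ) 1) (hlim : Tendsto δ atTop (nhds 0)) :
    Tendsto (fun n ↦ ∫ s in (1 - δ n)..1, betaWeight α s) atTop (nhds 0) := by
  have h0 : (0 : ℝ) ∈ Set.Icc (0 : ℝ) 1 := ⟨le_rfl, zero_le_one⟩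
  have h1 : (1 : ℝ) ∈ Set.Icc (0 : ℝ) 1 := ⟨zero_le_one, le_rfl⟩
  have hcont := intervalIntegral.continuousOn_primitive_interval'
    (intervalIntegrable_betaWeight hα0 hα1 h0 h1) (a := 1) (by simp)
  rw [Set.uIcc_of_le zero_le_one] at hcont
  have hlim' : Tendsto (fun n ↦ 1 - δ n) atTop (nhdsWithin 1 (Set.Icc 0 1)) := by
    refine tendsto_nhdsWithin_iff.2 ⟨by simpa using hlim.const_sub 1, .of_forall fun n ↦ ?_⟩
    exact ⟨by linarith [(hδ n).2], by linarith [(hδ n).1]⟩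
  have h := ((hcont 1 h1).tendsto.comp hlim').neg
  simp only [intervalIntegral.integral_same, neg_zero] at h
  refine h.congr fun n ↦ ?_
  rw [Function.comp_apply, ← intervalIntegral.integral_symm]

end BetaWeight

/-- The piecewise affine cutoff of height `1` on `[p, q]` with ramps of length `e`. -/
noncomputable def trapezoid (p q e t : ℝ) : ℝ := max 0 (min 1 (min ((t - p) / e) ((q - t) / e)))

lemma trapezoid_mem_Icc (p q e t : ℝ) : trapezoid p q e t ∈ Set.Icc (0 : ℝ) 1 :=
  ⟨le_max_left _ _, max_le zero_le_one (min_le_left _ _)⟩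

lemma measurable_trapezoid (p q e : ℝ) : Measurable (trapezoid p q e) := by
  unfold trapezoid
  fun_prop

lemma trapezoid_eq_one {p q e t : ℝ} (he : 0 < e) (ht : t ∈ Set.Icc (p + e) (q - e)) :
    trapezoid p q e t = 1 := by
  have h1 : 1 ≤ (t - p) / e := by rw [le_div_iff₀ he]; linarith [ht.1]
  have h2 : 1 ≤ (q - t) / e := by rw [le_div_iff₀ he]; linarith [ht.2]
  rw [trapezoid, min_eq_left (le_min h1 h2), max_eq_right zero_le_one]

lemma eq_trapezoid {F : ℝ → ℝ} {p q e : ℝ} (he : 0 < e) (hpq : 2 * e ≤ q - p)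
    (ha : ∀ t ∈ Set.Ico p (p + e), F t = (t - p) / e)
    (hb : ∀ t ∈ Set.Ico (p + e) (q - e), F t = 1)
    (hc : ∀ t ∈ Set.Ico (q - e) q, F t = (q - t) / e) {t : ℝ} (ht : t ∈ Set.Ico p q) :
    F t = trapezoid p q e t := by
  rcases lt_or_ge t (p + e) with h | h
  · have h0 : 0 ≤ (t - p) / e := div_nonneg (by linarith [ht.1]) he.le
    have h1 : (t - p) / e ≤ 1 := by rw [div_le_one he]; linarith
    have h2 : (t - p) / e ≤ (q - t) / e := div_le_div_of_nonneg_right (by linarith) he.le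
    rw [ha t ⟨ht.1, h⟩, trapezoid, min_eq_left h2, min_eq_right h1, max_eq_right h0]
  rcases lt_or_ge t (q - e) with h' | h'
  · rw [hb t ⟨h, h'⟩, trapezoid_eq_one he ⟨h, h'.le⟩]
  · have h0 : 0 ≤ (q - t) / e := div_nonneg (by linarith [ht.2]) he.le
    have h1 : (q - t) / e ≤ 1 := by rw [div_le_one he]; linarith
    have h2 : (q - t) / e ≤ (t - p) / e := div_le_div_of_nonneg_right (by linarith) he.le
    rw [hc t ⟨h', ht.2⟩, trapezoid, min_eq_right h2, min_eq_right h1, max_eq_right h0]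

lemma measurable_of_eqOn_of_eq_zero {s : ℕ → Set ℝ} (hs : ∀ k, MeasurableSet (s k)) {F : ℝ → ℝ}
    {g : ℕ → ℝ → ℝ} (hg : ∀ k, Measurable (g k)) (h : ∀ k, ∀ t ∈ s k, F t = g k t)
    (h0 : ∀ t, (∀ k, t ∉ s k) → F t = 0) : Measurable F := by
  intro S hS
  have hpre : F ⁻¹' S = (⋃ k, s k ∩ g k ⁻¹' S) ∪ ((⋃ k, s k)ᶜ ∩ {_t | (0 : ℝ) ∈ S}) := by
    ext t
    simp only [Set.mem_preimage, Set.mem_union, Set.mem_iUnion, Set.mem_inter_iff,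
      Set.mem_compl_iff, Set.mem_ofPred_eq, not_exists]
    constructor
    · intro ht
      by_cases hk : ∃ k, t ∈ s k
      · obtain ⟨k, hk⟩ := hk
        exact .inl ⟨k, hk, h k t hk ▸ ht⟩
      · push Not at hk
        exact .inr ⟨hk, h0 t hk ▸ ht⟩
    · rintro (⟨k, hk, ht⟩ | ⟨hk, ht⟩)
      · rwa [h k t hk]
      · rwa [h0 t hk]
  rw [hpre]
  exact (MeasurableSet.iUnion fun k ↦ (hs k).inter (hg k hS)).union
    ((MeasurableSet.iUnion hs).compl.inter (MeasurableSet.const _))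

lemma liminf_sub_limsup_le {u : ℝ → ℝ} {C c : ℝ} (hu : ∀ᶠ t in atTop, u t ∈ Set.Icc 0 C)
    {x y : ℕ → ℝ} (hx : Tendsto x atTop atTop) (hy : Tendsto y atTop atTop)
    (h : ∀ᶠ n in atTop, u (y n) - u (x n) ≤ c) :
    liminf u atTop - limsup u atTop ≤ c := by
  have hbelow : IsBoundedUnder (· ≥ ·) atTop u := ⟨0, eventually_map.2 (hu.mono fun _ h ↦ h.1)⟩
  have habove : IsBoundedUnder (· ≤ ·) atTop u := ⟨C, eventually_map.2 (hu.mono fun _ h ↦ h.2)⟩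
  refine le_of_forall_pos_le_add fun δ hδ ↦ ?_
  have h1 := eventually_lt_of_lt_liminf (b := liminf u atTop - δ / 2) (by linarith) hbelow
  have h2 := eventually_lt_of_limsup_lt (b := limsup u atTop + δ / 2) (by linarith) habove
  obtain ⟨n, hn, hn1, hn2⟩ := (h.and ((hy.eventually h1).and (hx.eventually h2))).exists
  linarith

/-- With the explicit data `b, η, a_k, ε_k, f₁, f₂, f = f₁ f₂` and
`u t = ∫_0^t f z (t-z)^(α-1) dz` of the counterexample construction, for every `N ≥ 1` such
that `I_α[1 - ε_N/a_{2N+1}, 1] < η/4` and `a_{2N}(a_1 - 1) ≥ 2` one has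
`u (a_{2N+2}) - u (a_{2N+1}) ≤ -η/4`; consequently `liminf u - limsup u ≤ -η/4`. -/
theorem stmt_2 (α b η : ℝ) (hα0 : 0 < α) (hα1 : α < 1) (hb0 : 0 < b) (hb1 : b < 1)
    (hb : (∫ s in (0:ℝ)..b, s ^ (-α) * (1 - s) ^ (α - 1))
        = ∫ s in b..(1:ℝ), s ^ (-α) * (1 - s) ^ (α - 1))
    (hη : η = ∫ s in (b ^ 3)..(b ^ 2), s ^ (-α) * (1 - s) ^ (α - 1))
    (a : ℕ → ℝ) (ha : ∀ k : ℕ, a k = b ^ (-(k : ℝ)))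
    (ε : ℕ → ℝ) (hε : ∀ k : ℕ, ε k = (1 - b ^ 2) / 4 * η * b ^ (2 * k))
    (f₁ f₂ : ℝ → ℝ)
    (hf₁a : ∀ t ∈ Set.Icc (0:ℝ) 1, f₁ t = 1)
    (hf₁b : ∀ t : ℝ, 1 ≤ t → f₁ t = t ^ (-α))
    (hf₂a : ∀ k : ℕ, ∀ t ∈ Set.Ico (a (2*k)) (a (2*k) + ε k),
      f₂ t = (t - a (2*k)) / ε k)
    (hf₂b : ∀ k : ℕ, ∀ t ∈ Set.Ico (a (2*k) + ε k) (a (2*k+1) - ε k), f₂ t = 1)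
    (hf₂c : ∀ k : ℕ, ∀ t ∈ Set.Ico (a (2*k+1) - ε k) (a (2*k+1)),
      f₂ t = (a (2*k+1) - t) / ε k)
    (hf₂z : ∀ t : ℝ, (∀ k : ℕ, t ∉ Set.Ico (a (2*k)) (a (2*k+1))) → f₂ t = 0)
    (u : ℝ → ℝ)
    (hu : ∀ t : ℝ, u t = ∫ z in (0:ℝ)..t, f₁ z * f₂ z * (t - z) ^ (α - 1)) :
    (∀ N : ℕ, 1 ≤ N →
      (∫ s in (1 - ε N / a (2*N+1))..(1:ℝ), s ^ (-α) * (1 - s) ^ (α - 1)) < η / 4 →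
      2 ≤ a (2*N) * (a 1 - 1) →
      u (a (2*N+2)) - u (a (2*N+1)) ≤ -(η / 4)) ∧
    liminf u atTop - limsup u atTop ≤ -(η / 4) := by
  change ∫ s in (0 : ℝ)..b, betaWeight α s = ∫ s in b..(1 : ℝ), betaWeight α s at hb
  change η = ∫ s in (b ^ 3)..(b ^ 2), betaWeight α s at hη
  -- the sequence `a`
  have ha' (k : ℕ) : a k = (b ^ k)⁻¹ := by rw [ha, Real.rpow_neg hb0.le, Real.rpow_natCast]
  have ha0 : a 0 = 1 := by simp [ha']
  have hasucc (k : ℕ) : a (k + 1) * b = a k := by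
    rw [ha', ha', pow_succ]; field_simp
  have hapos (k : ℕ) : 0 < a k := by rw [ha']; positivity
  have hamono : StrictMono a := strictMono_nat_of_lt_succ fun k ↦ by
    nlinarith [hasucc k, hapos (k + 1)]
  have haone (k : ℕ) : 1 ≤ a k := ha0 ▸ hamono.monotone k.zero_le
  have ha1b : a 1 * b = 1 := by simpa [ha0] using hasucc 0
  have ha1 : 1 < a 1 := ha0 ▸ hamono zero_lt_one
  have hatop : Tendsto a atTop atTop := by
    have h : a = fun k ↦ (b⁻¹) ^ k := by ext k; rw [ha', inv_pow]
    rw [h]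
    exact tendsto_pow_atTop_atTop_of_one_lt ((one_lt_inv₀ hb0).2 hb1)
  have hgap (k : ℕ) : a (k + 1) - a k = a k * (a 1 - 1) := by
    linear_combination a 1 * (hasucc k) - a (k + 1) * ha1b
  -- the number `η`
  have hb2 : b ^ 2 < b := by nlinarith
  have hb3 : b ^ 3 < b ^ 2 := by nlinarith [pow_pos hb0 2]
  have hb3pos : 0 < b ^ 3 := by positivity
  have hη0 : 0 < η := by
    rw [hη]
    exact intervalIntegral.intervalIntegral_pos_of_pos_on
      (intervalIntegrable_betaWeight hα0 hα1 ⟨by linarith, by linarith⟩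
        ⟨by linarith, by linarith⟩)
      (fun s hs ↦ betaWeight_pos ⟨by linarith [hs.1], by linarith [hs.2]⟩) hb3
  have hηle : (1 - b ^ 2) * η ≤ a 1 - 1 := by
    have h := integral_betaWeight_le_mul hα0 hα1 (C := (b ^ 3)⁻¹ * (1 - b ^ 2)⁻¹) hb3pos.le
      hb3.le (by linarith) fun s hs ↦ betaWeight_le_inv_mul hα0 hα1 hb3pos (by linarith)
        (by linarith) hs.1 hs.2
    rw [← hη] at h
    have h1 : 0 < 1 - b ^ 2 := by linarith
    have ha1' : a 1 = b⁻¹ := by simp [ha']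
    calc (1 - b ^ 2) * η ≤ (1 - b ^ 2) * ((b ^ 3)⁻¹ * (1 - b ^ 2)⁻¹ * (b ^ 2 - b ^ 3)) := by gcongr
      _ = a 1 - 1 := by rw [ha1']; field_simp
  have hε0 (k : ℕ) : 0 < ε k := by
    rw [hε]
    have : 0 < 1 - b ^ 2 := by linarith
    positivity
  have hεle (k : ℕ) : ε k ≤ (1 - b ^ 2) * η / 4 := by
    rw [hε]
    have h1 : 0 < 1 - b ^ 2 := by linarith
    have h2 : b ^ (2 * k) ≤ 1 := pow_le_one₀ hb0.le hb1.le
    nlinarith [mul_pos h1 hη0]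
  have hεη (k : ℕ) : ε k ≤ η / 4 := by nlinarith [hεle k, mul_pos (pow_pos hb0 2) hη0]
  have hεgap (k : ℕ) : 4 * ε k ≤ a (2 * k + 1) - a (2 * k) := by
    rw [hgap]
    nlinarith [hεle k, haone (2 * k)]
  -- the cutoff `f₂`
  have htrap (k : ℕ) (t : ℝ) (ht : t ∈ Set.Ico (a (2 * k)) (a (2 * k + 1))) :
      f₂ t = trapezoid (a (2 * k)) (a (2 * k + 1)) (ε k) t :=
    eq_trapezoid (hε0 k) (by linarith [hεgap k, hε0 k]) (hf₂a k) (hf₂b k) (hf₂c k) ht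
  have hmeas : Measurable f₂ := measurable_of_eqOn_of_eq_zero (fun _ ↦ measurableSet_Ico)
    (fun k ↦ measurable_trapezoid _ _ _) htrap hf₂z
  have h01 (t : ℝ) : f₂ t ∈ Set.Icc (0 : ℝ) 1 := by
    by_cases h : ∃ k : ℕ, t ∈ Set.Ico (a (2 * k)) (a (2 * k + 1))
    · obtain ⟨k, hk⟩ := h
      exact htrap k t hk ▸ trapezoid_mem_Icc _ _ _ _
    · push Not at h
      simp [hf₂z t h]
  have hzero (k : ℕ) (t : ℝ) (ht : t ∈ Set.Icc (a (2 * k + 1)) (a (2 * k + 2))) : f₂ t = 0 := by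
    rcases ht.2.lt_or_eq with h | h
    · refine hf₂z t fun j hj ↦ ?_
      rcases le_or_gt j k with hjk | hjk
      · linarith [hj.2, ht.1, hamono.monotone (show 2 * j + 1 ≤ 2 * k + 1 by lia)]
      · linarith [hj.1, hamono.monotone (show 2 * k + 2 ≤ 2 * j by lia)]
    · rw [hf₂a (k + 1) t ⟨h.ge, by linarith [hε0 (k + 1), show a (2 * (k + 1)) = t from h.symm]⟩,
        h, show 2 * (k + 1) = 2 * k + 2 by ring, sub_self, zero_div]
  have hone (k : ℕ) (t : ℝ) (ht : t ∈ Set.Icc (a (2 * k) + ε k) (a (2 * k + 1) - ε k)) :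
      f₂ t = 1 := by
    rw [htrap k t ⟨by linarith [ht.1, hε0 k], by linarith [ht.2, hε0 k]⟩,
      trapezoid_eq_one (hε0 k) ht]
  have hu' (t : ℝ) (ht : 0 < t) : u t = ∫ s in (0 : ℝ)..1, betaWeight α s * f₂ (t * s) := by
    rw [hu, ← integral_rpow_mul_eq_integral_betaWeight ht]
    refine intervalIntegral.integral_congr fun z hz ↦ ?_
    rw [Set.uIcc_of_le ht.le] at hz
    rcases le_or_gt 1 z with h | h
    · simp only [hf₁b z h]
    · have : f₂ z = 0 := hf₂z z fun k hk ↦ by linarith [hk.1, haone (2 * k)]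
      simp [this]
  have hmeas' (t : ℝ) : Measurable fun s ↦ f₂ (t * s) := hmeas.comp (measurable_const_mul t)
  have hmain (N : ℕ) (hN : 1 ≤ N)
      (hI : ∫ s in (1 - ε N / a (2 * N + 1))..(1 : ℝ), betaWeight α s < η / 4)
      (hT : 2 ≤ a (2 * N) * (a 1 - 1)) : u (a (2 * N + 2)) - u (a (2 * N + 1)) ≤ -(η / 4) := by
    rw [hu' _ (hapos _), hu' _ (hapos _)]
    -- the upper bound at `a (2N+2)`
    have hup : ∫ s in (0 : ℝ)..1, betaWeight α s * f₂ (a (2 * N + 2) * s)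
        ≤ (∫ s in (0 : ℝ)..b, betaWeight α s) - η := by
      obtain ⟨M, rfl⟩ : ∃ M, N = M + 1 := ⟨N - 1, by lia⟩
      have e1 : a (2 * (M + 1) + 2) * b = a (2 * (M + 1) + 1) := hasucc _
      have e2 : a (2 * (M + 1) + 1) * b = a (2 * M + 2) := hasucc _
      have e3 : a (2 * M + 2) * b = a (2 * M + 1) := hasucc _
      have e4 : a (2 * (M + 1) + 2) * b ^ 2 = a (2 * M + 2) := by
        rw [← e2, ← e1]; ring
      have e5 : a (2 * (M + 1) + 2) * b ^ 3 = a (2 * M + 1) := by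
        rw [← e3, ← e4]; ring
      have hpos := hapos (2 * (M + 1) + 2)
      rw [hη]
      refine integral_betaWeight_mul_le_sub hα0 hα1 hb3pos.le hb3.le hb2.le hb1.le (hmeas' _)
        (fun s ↦ h01 _) (fun s hs ↦ hzero M _ ⟨?_, ?_⟩) (fun s hs ↦ hzero (M + 1) _ ⟨?_, ?_⟩)
      · rw [← e5]; exact mul_le_mul_of_nonneg_left hs.1 hpos.le
      · rw [← e4]; exact mul_le_mul_of_nonneg_left hs.2 hpos.le
      · rw [← e1]; exact mul_le_mul_of_nonneg_left hs.1 hpos.le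
      · exact mul_le_of_le_one_right hpos.le hs.2
    -- the lower bound at `a (2N+1)`
    have hTpos := hapos (2 * N + 1)
    have hTb : a (2 * N + 1) * b = a (2 * N) := hasucc _
    have hg := hgap (2 * N)
    have hεg := hεgap N
    have hεpos := hε0 N
    set T := a (2 * N + 1) with hTdef
    set δ := ε N / T with hδ
    have hδ0 : 0 < δ := div_pos hεpos hTpos
    have hTδ : T * δ = ε N := mul_div_cancel₀ _ hTpos.ne'
    have hδb : b + δ ≤ 1 - δ := by
      refine le_of_mul_le_mul_left ?_ hTpos
      linarith
    have hb01 : b ∈ Set.Icc (0 : ℝ) 1 := ⟨hb0.le, hb1.le⟩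
    have hp01 : b + δ ∈ Set.Icc (0 : ℝ) 1 := ⟨by linarith, by linarith⟩
    have hq01 : 1 - δ ∈ Set.Icc (0 : ℝ) 1 := ⟨by linarith, by linarith⟩
    have hlow : ∫ s in (b + δ)..(1 - δ), betaWeight α s
        ≤ ∫ s in (0 : ℝ)..1, betaWeight α s * f₂ (T * s) := by
      refine integral_betaWeight_le_integral_mul hα0 hα1 hp01.1 hδb hq01.2 (hmeas' _)
        (fun s ↦ h01 _) fun s hs ↦ hone N _ ⟨?_, ?_⟩
      · have := mul_le_mul_of_nonneg_left hs.1 hTpos.le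
        linarith
      · have := mul_le_mul_of_nonneg_left hs.2 hTpos.le
        linarith
    have hramp : ∫ s in b..(b + δ), betaWeight α s ≤ η / 4 := by
      have h := integral_betaWeight_le_mul hα0 hα1 (C := T) hb0.le (by linarith : b ≤ b + δ)
        hp01.2 fun s hs ↦ betaWeight_le hα0 hα1 hTpos
          (by nlinarith [mul_le_mul_of_nonneg_left hs.1 hTpos.le, haone (2 * N)])
          (by linarith [mul_le_mul_of_nonneg_left hs.2 hTpos.le])
      have := hεη N
      rw [add_sub_cancel_left, hTδ] at h
      linarith
    have hint {c d : ℝ} (hc : c ∈ Set.Icc (0 : ℝ) 1) (hd : d ∈ Set.Icc (0 : ℝ) 1) :=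
      intervalIntegrable_betaWeight hα0 hα1 hc hd
    have hsplit1 := intervalIntegral.integral_add_adjacent_intervals
      (hint hb01 hp01) (hint hp01 ⟨zero_le_one, le_rfl⟩)
    have hsplit2 := intervalIntegral.integral_add_adjacent_intervals
      (hint hp01 hq01) (hint hq01 ⟨zero_le_one, le_rfl⟩)
    linarith
  refine ⟨hmain, ?_⟩
  have htop (i : ℕ) : Tendsto (fun N : ℕ ↦ 2 * N + i) atTop atTop :=
    tendsto_atTop_mono (fun N ↦ show N ≤ 2 * N + i by lia) tendsto_id
  refine liminf_sub_limsup_le (C := ∫ s in (0 : ℝ)..1, betaWeight α s) ?_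
    (hatop.comp (htop 1)) (hatop.comp (htop 2)) ?_
  · filter_upwards [eventually_gt_atTop 0] with t ht
    rw [hu' t ht]
    exact ⟨integral_betaWeight_mul_nonneg le_rfl zero_le_one le_rfl fun s ↦ h01 _,
      integral_betaWeight_mul_le hα0 hα1 le_rfl zero_le_one le_rfl (hmeas' t) fun s ↦ h01 _⟩
  · have hδmem (N : ℕ) : ε N / a (2 * N + 1) ∈ Set.Icc (0 : ℝ) 1 :=
      ⟨(div_pos (hε0 N) (hapos _)).le, by
        rw [div_le_one (hapos _)]
        linarith [hεgap N, hε0 N, hapos (2 * N)]⟩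
    have hδlim : Tendsto (fun N ↦ ε N / a (2 * N + 1)) atTop (nhds 0) := by
      refine squeeze_zero (fun N ↦ (hδmem N).1)
        (fun N ↦ div_le_div_of_nonneg_right (hεη N) (hapos _).le) ?_
      exact (hatop.comp (htop 1)).const_div_atTop (η / 4)
    have hev1 := (tendsto_integral_betaWeight_one hα0 hα1 hδmem hδlim).eventually
      (gt_mem_nhds (show (0 : ℝ) < η / 4 by linarith))
    have hev2 := ((hatop.comp (htop 0)).atTop_mul_const
      (sub_pos.2 ha1)).eventually_ge_atTop 2
    filter_upwards [eventually_ge_atTop 1, hev1, hev2] with N hN h1 h2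
    exact hmain N hN h1 h2
end

section
/- Let 0 < α < 1, let b ∈ (0,1) satisfy I_α[0,b] = I_α[b,1], and set a_k := b^{−k}. Then for every integer N ≥ 1, ∑_{k=0}^{N} ( I_α[a_{2k}/a_{2N+2}, a_{2k+1}/a_{2N+2}] − I_α[a_{2k}/a_{2N+1}, a_{2k+1}/a_{2N+1}] ) ≤ −I_α[b³, b²]. -/
open MeasureTheory Filter

theorem intervalIntegrable_rpow_mul_one_sub_rpow {p q : ℝ} (hp : 0 < p) (hq : 0 < q) :
    IntervalIntegrable (fun s : ℝ => s ^ (p - 1) * (1 - s) ^ (q - 1)) volume 0 1 := by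
  have h := (Complex.betaIntegral_convergent (u := (p : ℂ)) (v := (q : ℂ))
    (by simpa using hp) (by simpa using hq)).norm
  refine h.congr ?_
  rw [Set.uIoc_of_le zero_le_one]
  intro s hs
  have h1 : (s : ℂ) ^ ((p : ℂ) - 1) = ((s ^ (p - 1) : ℝ) : ℂ) := by
    rw [Complex.ofReal_cpow hs.1.le]; push_cast; rfl
  have h2 : (1 - (s : ℂ)) ^ ((q : ℂ) - 1) = (((1 - s) ^ (q - 1) : ℝ) : ℂ) := by
    rw [Complex.ofReal_cpow (by linarith [hs.2])]; push_cast; rfl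
  simp only [h1, h2, norm_mul, Complex.norm_real, Real.norm_eq_abs]
  rw [abs_of_nonneg (Real.rpow_nonneg hs.1.le _),
    abs_of_nonneg (Real.rpow_nonneg (by linarith [hs.2]) _)]

/-- If `F` is monotone along the geometric sequence `b ^ j` and gives the pieces below and above
`b` equal mass, the alternating sum of the masses of the pieces `[b ^ (j + 1), b ^ j]` is at most
minus the mass of `[b ^ 3, b ^ 2]`, with room `F (b ^ (2 * N + 2))` to spare. -/
theorem sum_alternating_increments_le {F : ℝ → ℝ} {b : ℝ}
    (hF : ∀ j : ℕ, F (b ^ (j + 1)) ≤ F (b ^ j)) (hb : F b = F 1 - F b) {N : ℕ} (hN : 1 ≤ N) :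
    ∑ j ∈ Finset.range (N + 1),
      ((F (b ^ (2 * j + 1)) - F (b ^ (2 * j + 2))) - (F (b ^ (2 * j)) - F (b ^ (2 * j + 1))))
      ≤ -(F (b ^ 2) - F (b ^ 3)) - F (b ^ (2 * N + 2)) := by
  induction N, hN using Nat.le_induction with
  | base =>
    simp only [Finset.sum_range_succ, Finset.sum_range_zero]
    norm_num
    linarith [hF 2]
  | succ n _ ih =>
    rw [Finset.sum_range_succ]
    have h := hF (2 * n + 2)
    simp only [mul_add, mul_one, add_assoc] at *
    norm_num at *
    linarith

theorem stmt_3 (α b : ℝ) (hα0 : 0 < α) (hα1 : α < 1) (hb0 : 0 < b) (hb1 : b < 1)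
    (hb : (∫ s in (0:ℝ)..b, s ^ (-α) * (1 - s) ^ (α - 1))
        = ∫ s in b..(1:ℝ), s ^ (-α) * (1 - s) ^ (α - 1))
    (a : ℕ → ℝ) (ha : ∀ k : ℕ, a k = b ^ (-(k : ℝ))) :
    ∀ N : ℕ, 1 ≤ N →
      (∑ k ∈ Finset.range (N + 1),
        ((∫ s in (a (2*k) / a (2*N+2))..(a (2*k+1) / a (2*N+2)),
            s ^ (-α) * (1 - s) ^ (α - 1))
         - ∫ s in (a (2*k) / a (2*N+1))..(a (2*k+1) / a (2*N+1)),
            s ^ (-α) * (1 - s) ^ (α - 1)))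
      ≤ -(∫ s in (b ^ 3)..(b ^ 2), s ^ (-α) * (1 - s) ^ (α - 1)) := by
  intro N hN
  have hint : IntervalIntegrable (fun s : ℝ => s ^ (-α) * (1 - s) ^ (α - 1)) volume 0 1 := by
    have h := intervalIntegrable_rpow_mul_one_sub_rpow (sub_pos.2 hα1) hα0
    rwa [show 1 - α - 1 = -α by ring] at h
  have hpos : ∀ s ∈ Set.Icc (0 : ℝ) 1, 0 ≤ s ^ (-α) * (1 - s) ^ (α - 1) := fun s hs =>
    mul_nonneg (Real.rpow_nonneg hs.1 _) (Real.rpow_nonneg (by linarith [hs.2]) _)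
  set f : ℝ → ℝ := fun s => s ^ (-α) * (1 - s) ^ (α - 1)
  have hsub : ∀ {x y : ℝ}, x ∈ Set.Icc (0 : ℝ) 1 → y ∈ Set.Icc (0 : ℝ) 1 →
      ∫ s in x..y, f s = (∫ s in (0 : ℝ)..y, f s) - ∫ s in (0 : ℝ)..x, f s := by
    have h0 : ∀ {x : ℝ}, x ∈ Set.Icc (0 : ℝ) 1 → IntervalIntegrable f volume 0 x := fun hx =>
      hint.mono_set (by
        rw [Set.uIcc_of_le hx.1, Set.uIcc_of_le zero_le_one]
        exact Set.Icc_subset_Icc le_rfl hx.2)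
    intro x y hx hy
    exact (intervalIntegral.integral_interval_sub_left (h0 hy) (h0 hx)).symm
  have hnn : ∀ {x y : ℝ}, x ∈ Set.Icc (0 : ℝ) 1 → y ∈ Set.Icc (0 : ℝ) 1 → x ≤ y →
      0 ≤ ∫ s in x..y, f s := fun hx hy hxy =>
    intervalIntegral.integral_nonneg hxy fun s hs => hpos s ⟨hx.1.trans hs.1, hs.2.trans hy.2⟩
  have hmem : ∀ j : ℕ, b ^ j ∈ Set.Icc (0 : ℝ) 1 := fun j =>
    ⟨pow_nonneg hb0.le j, pow_le_one₀ hb0.le hb1.le⟩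
  have hdiv : ∀ i j : ℕ, a i / a (i + j) = b ^ j := fun i j => by
    rw [ha, ha, ← Real.rpow_sub hb0, ← Real.rpow_natCast]
    congr 1
    push_cast
    ring
  have key := sum_alternating_increments_le (F := fun x => ∫ s in (0 : ℝ)..x, f s) (b := b)
    (fun j => by
      have h := hnn (hmem (j + 1)) (hmem j) (pow_le_pow_of_le_one hb0.le hb1.le j.le_succ)
      rw [hsub (hmem _) (hmem _)] at h
      exact sub_nonneg.1 h)
    (hb.trans (hsub ⟨hb0.le, hb1.le⟩ ⟨zero_le_one, le_rfl⟩)) hN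
  have hlast := hnn ⟨le_rfl, zero_le_one⟩ (hmem (2 * N + 2)) (hmem _).1
  rw [hsub (hmem 3) (hmem 2), ← Finset.sum_range_reflect]
  refine le_trans (le_of_eq (Finset.sum_congr rfl fun j hj => ?_))
    (key.trans (sub_le_self _ hlast))
  obtain ⟨k, rfl⟩ : ∃ k, N = j + k := Nat.exists_eq_add_of_le (by simp at hj; omega)
  have hk : j + k + 1 - 1 - j = k := by omega
  have e1 := hdiv (2 * k) (2 * j + 2)
  have e2 := hdiv (2 * k + 1) (2 * j + 1)
  have e3 := hdiv (2 * k) (2 * j + 1)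
  have e4 := hdiv (2 * k + 1) (2 * j)
  rw [show 2 * k + (2 * j + 2) = 2 * (j + k) + 2 by ring] at e1
  rw [show 2 * k + 1 + (2 * j + 1) = 2 * (j + k) + 2 by ring] at e2
  rw [show 2 * k + (2 * j + 1) = 2 * (j + k) + 1 by ring] at e3
  rw [show 2 * k + 1 + 2 * j = 2 * (j + k) + 1 by ring] at e4
  rw [hk, e1, e2, e3, e4, hsub (hmem _) (hmem _), hsub (hmem _) (hmem _)]
end

section
/- Let 0 < α < 1 and let f : [0,∞) → ℝ be measurable with f(z) = 0 for z ∈ [0,1] and 0 ≤ f(z) ≤ z^{−α} for z ≥ 1. Then for every t ≥ 0, 0 ≤ ∫_0^t f(z) (t − z)^{α−1} dz ≤ π/sin(πα); in particular the function u(t) = ∫_0^t f(z)(t−z)^{α−1} dz is bounded on [0,∞) and vanishes on [0,1]. -/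
open MeasureTheory Filter

/-- The scaling-invariant Beta integral with exponents `-α` and `α - 1`. -/
theorem integral_rpow_neg_mul_sub_rpow {α : ℝ} (hα0 : 0 < α) (hα1 : α < 1) {t : ℝ} (ht : 0 < t) :
    ∫ z in (0:ℝ)..t, z ^ (-α) * (t - z) ^ (α - 1) = Real.pi / Real.sin (Real.pi * α) := by
  have h1 := Complex.betaIntegral_scaled ((1 - α : ℝ) : ℂ) (α : ℂ) ht
  have h2 := Complex.Gamma_mul_Gamma_eq_betaIntegral (s := ((1 - α : ℝ) : ℂ)) (t := (α : ℂ))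
    (by simpa using hα1) (by simpa using hα0)
  have h3 : ((1 - α : ℝ) : ℂ) + (α : ℂ) = 1 := by push_cast; ring
  rw [h3, Complex.Gamma_one, one_mul, mul_comm, Complex.Gamma_ofReal, Complex.Gamma_ofReal,
    ← Complex.ofReal_mul, Real.Gamma_mul_Gamma_one_sub] at h2
  rw [h3, sub_self, Complex.cpow_zero, one_mul, ← h2] at h1
  rw [← Complex.ofReal_inj, ← h1, ← intervalIntegral.integral_ofReal]
  refine intervalIntegral.integral_congr fun z hz => ?_
  rw [Set.uIcc_of_le ht.le] at hz
  simp only [Complex.ofReal_mul]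
  rw [Complex.ofReal_cpow hz.1, Complex.ofReal_cpow (sub_nonneg.2 hz.2)]
  push_cast
  congr 2
  ring

/-- For `0 < α < 1` and `f` measurable with `f = 0` on `[0,1]` and
`0 ≤ f z ≤ z^{-α}` for `z ≥ 1`, the fractional integral
`u t = ∫_0^t f z (t-z)^{α-1} dz` satisfies `0 ≤ u t ≤ π / sin (π α)` for all `t ≥ 0`;
in particular `u` is bounded on `[0,∞)` and vanishes on `[0,1]`. -/
theorem stmt_6 (α : ℝ) (hα0 : 0 < α) (hα1 : α < 1)
    (f : ℝ → ℝ) (hf : Measurable f)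
    (hf0 : ∀ z ∈ Set.Icc (0:ℝ) 1, f z = 0)
    (hf1 : ∀ z : ℝ, 1 ≤ z → 0 ≤ f z ∧ f z ≤ z ^ (-α)) :
    (∀ t : ℝ, 0 ≤ t →
      0 ≤ (∫ z in (0:ℝ)..t, f z * (t - z) ^ (α - 1)) ∧
      (∫ z in (0:ℝ)..t, f z * (t - z) ^ (α - 1)) ≤ Real.pi / Real.sin (Real.pi * α)) ∧
    (∀ t ∈ Set.Icc (0:ℝ) 1, (∫ z in (0:ℝ)..t, f z * (t - z) ^ (α - 1)) = 0) := by
  have pos : 0 < Real.pi / Real.sin (Real.pi * α) := by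
    refine div_pos Real.pi_pos (Real.sin_pos_of_pos_of_lt_pi (mul_pos Real.pi_pos hα0) ?_)
    nlinarith [Real.pi_pos]
  have nonneg : ∀ z : ℝ, 0 ≤ z → 0 ≤ f z := fun z hz => by
    rcases le_total z 1 with h | h
    · exact (hf0 z ⟨hz, h⟩).ge
    · exact (hf1 z h).1
  have upper : ∀ z : ℝ, 0 ≤ z → f z ≤ z ^ (-α) := fun z hz => by
    rcases le_total z 1 with h | h
    · exact (hf0 z ⟨hz, h⟩).trans_le (Real.rpow_nonneg hz _)
    · exact (hf1 z h).2
  refine ⟨fun t ht => ⟨?_, ?_⟩, fun t ht => ?_⟩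
  · exact intervalIntegral.integral_nonneg ht fun z hz =>
      mul_nonneg (nonneg z hz.1) (Real.rpow_nonneg (sub_nonneg.2 hz.2) _)
  · rcases ht.eq_or_lt with rfl | ht'
    · simpa using pos.le
    have key := integral_rpow_neg_mul_sub_rpow hα0 hα1 ht'
    have hint : IntervalIntegrable (fun z : ℝ => z ^ (-α) * (t - z) ^ (α - 1)) volume 0 t :=
      intervalIntegral.intervalIntegrable_of_integral_ne_zero (key.trans_ne pos.ne')
    have le : ∀ z ∈ Set.Icc 0 t,
        f z * (t - z) ^ (α - 1) ≤ z ^ (-α) * (t - z) ^ (α - 1) := fun z hz =>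
      mul_le_mul_of_nonneg_right (upper z hz.1) (Real.rpow_nonneg (sub_nonneg.2 hz.2) _)
    rw [← key]
    refine intervalIntegral.integral_mono_on ht (hint.mono_fun' ?_ ?_) hint le
    · exact (hf.mul ((measurable_const.sub measurable_id).pow_const _)).aestronglyMeasurable
    · refine (ae_restrict_iff' measurableSet_uIoc).2 (ae_of_all _ fun z hz => ?_)
      rw [Set.uIoc_of_le ht] at hz
      exact (Real.norm_of_nonneg (mul_nonneg (nonneg z hz.1.le)
        (Real.rpow_nonneg (sub_nonneg.2 hz.2) _))).trans_le (le z ⟨hz.1.le, hz.2⟩)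
  · refine intervalIntegral.integral_zero_ae (ae_of_all _ fun z hz => ?_)
    rw [Set.uIoc_of_le ht.1] at hz
    rw [hf0 z ⟨hz.1.le, hz.2.trans ht.2⟩, zero_mul]
end

section
/- Let 0 < α < 1, A > 0 and k ≥ 1. There exists a unique function E : [0,∞) → ℝ that is continuous on [0,∞), continuously differentiable on (0,∞), positive, with E(0) = 1, and satisfying for every t > 0 the Caputo fractional ODE (1/Γ(1−α)) ∫_0^t E'(s) (t − s)^{−α} ds + A E(t)^k = 0 (the integral converging absolutely). Moreover E is nonincreasing and E(t) → 0 as t → ∞, and there exists C > 0 such that E(t) ≥ C t^{−α/k} for all large t, while for every ε ∈ (0, α/k) there exists C_ε > 0 such that E(t) ≤ C_ε t^{−(α/k − ε)} for all large t. -/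
open MeasureTheory Filter

/-- `E` is a positive solution on `[0,∞)` of the Caputo fractional ODE
`∂_t^α E + A E^k = 0`, `E(0) = 1`, with the classical Caputo derivative
`∂_t^α E(t) = (1/Γ(1-α)) ∫_0^t E'(s)(t-s)^{-α} ds` (absolutely convergent). -/
def IsCaputoODESolution (α A k : ℝ) (E : ℝ → ℝ) : Prop :=
  ContinuousOn E (Set.Ici 0) ∧
  ContDiffOn ℝ 1 E (Set.Ioi 0) ∧
  (∀ t : ℝ, 0 ≤ t → 0 < E t) ∧
  E 0 = 1 ∧
  ∀ t : ℝ, 0 < t →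
    MeasureTheory.IntegrableOn (fun s => deriv E s * (t - s) ^ (-α)) (Set.Ioc 0 t)
      MeasureTheory.volume ∧
    (1 / Real.Gamma (1 - α)) * (∫ s in (0:ℝ)..t, deriv E s * (t - s) ^ (-α))
      + A * E t ^ k = 0

section

open Set Topology intervalIntegral

/-- The Riemann-Liouville integral `∫_0^t (t-s)^{α-1} h(s) ds`, without the factor `1/Γ(α)`,
rescaled to the unit interval. -/
noncomputable def fracInt (α : ℝ) (h : ℝ → ℝ) (t : ℝ) : ℝ :=
  t ^ α * ∫ r in (0:ℝ)..1, (1 - r) ^ (α - 1) * h (r * t)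

lemma intervalIntegrable_sub_rpow {β : ℝ} (hβ : 0 < β) (a t : ℝ) :
    IntervalIntegrable (fun s : ℝ => (t - s) ^ (β - 1)) volume a t := by
  have := (intervalIntegrable_rpow' (a := 0) (b := t - a) (r := β - 1) (by linarith)).comp_sub_left t
  simpa using this.symm

lemma integral_one_sub_rpow {β : ℝ} (hβ : 0 < β) :
    ∫ r in (0:ℝ)..1, (1 - r) ^ (β - 1) = 1 / β := by
  rw [intervalIntegral.integral_comp_sub_left (fun x : ℝ => x ^ (β - 1)) 1]
  rw [integral_rpow (Or.inl (by linarith))]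
  simp [Real.zero_rpow hβ.ne']

lemma intervalIntegrable_fracInt {α : ℝ} (hα : 0 < α) {h : ℝ → ℝ} (hh : Continuous h) (t : ℝ) :
    IntervalIntegrable (fun r : ℝ => (1 - r) ^ (α - 1) * h (r * t)) volume 0 1 :=
  (intervalIntegrable_sub_rpow hα 0 1).mul_continuousOn (by fun_prop)

lemma fracInt_continuous {α : ℝ} (hα : 0 < α) {h : ℝ → ℝ} (hh : Continuous h) :
    Continuous (fracInt α h) := by
  refine (Real.continuous_rpow_const hα.le).mul ?_
  rw [continuous_iff_continuousAt]
  intro t₀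
  obtain ⟨M, hM⟩ := (isCompact_Icc (a := -(|t₀| + 1)) (b := |t₀| + 1)).exists_bound_of_continuousOn
    hh.continuousOn
  refine intervalIntegral.continuousAt_of_dominated_interval
    (bound := fun r => (1 - r) ^ (α - 1) * M) ?_ ?_ ?_ ?_
  · exact Eventually.of_forall fun t => (intervalIntegrable_fracInt hα hh t).def'.1
  · filter_upwards [Metric.ball_mem_nhds t₀ one_pos] with t ht
    rw [Metric.mem_ball, Real.dist_eq] at ht
    refine Eventually.of_forall fun r hr => ?_
    rw [uIoc_of_le zero_le_one] at hr
    rw [norm_mul, Real.norm_of_nonneg (Real.rpow_nonneg (by linarith [hr.2]) _)]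
    refine mul_le_mul_of_nonneg_left (hM _ ?_) (Real.rpow_nonneg (by linarith [hr.2]) _)
    rw [mem_Icc, ← abs_le, abs_mul, abs_of_pos hr.1]
    have h1 : |t| ≤ |t₀| + 1 := by
      have := abs_sub_abs_le_abs_sub t t₀
      linarith
    nlinarith [hr.1, hr.2, abs_nonneg t]
  · exact (intervalIntegrable_sub_rpow hα 0 1).mul_const M
  · exact Eventually.of_forall fun r _ => by fun_prop

lemma abs_fracInt_le {α : ℝ} (hα : 0 < α) {h g : ℝ → ℝ} (hh : Continuous h) (hg : Continuous g)
    {t : ℝ} (ht : 0 ≤ t) (hle : ∀ s ∈ Icc 0 t, |h s| ≤ g s) :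
    |fracInt α h t| ≤ fracInt α g t := by
  unfold fracInt
  rw [abs_mul, abs_of_nonneg (Real.rpow_nonneg ht α)]
  refine mul_le_mul_of_nonneg_left ?_ (Real.rpow_nonneg ht α)
  refine (intervalIntegral.abs_integral_le_integral_abs zero_le_one).trans ?_
  refine intervalIntegral.integral_mono_on zero_le_one (intervalIntegrable_fracInt hα hh t).abs
    (intervalIntegrable_fracInt hα hg t) fun r hr => ?_
  have h0 := Real.rpow_nonneg (sub_nonneg.2 hr.2) (α - 1)
  rw [abs_mul, abs_of_nonneg h0]
  exact mul_le_mul_of_nonneg_left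
    (hle _ ⟨mul_nonneg hr.1 ht, mul_le_of_le_one_left ht hr.2⟩) h0

lemma fracInt_mono {α : ℝ} (hα : 0 < α) {h g : ℝ → ℝ} (hh : Continuous h) (hg : Continuous g)
    {t : ℝ} (ht : 0 ≤ t) (hle : ∀ s ∈ Icc 0 t, h s ≤ g s) :
    fracInt α h t ≤ fracInt α g t := by
  refine mul_le_mul_of_nonneg_left ?_ (Real.rpow_nonneg ht α)
  refine intervalIntegral.integral_mono_on zero_le_one (intervalIntegrable_fracInt hα hh t)
    (intervalIntegrable_fracInt hα hg t) fun r hr => ?_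
  exact mul_le_mul_of_nonneg_left (hle _ ⟨mul_nonneg hr.1 ht, mul_le_of_le_one_left ht hr.2⟩)
    (Real.rpow_nonneg (sub_nonneg.2 hr.2) (α - 1))

lemma fracInt_const {α : ℝ} (hα : 0 < α) (M t : ℝ) :
    fracInt α (fun _ => M) t = t ^ α * M / α := by
  rw [fracInt, intervalIntegral.integral_mul_const, integral_one_sub_rpow hα]
  ring

lemma fracInt_sub {α : ℝ} (hα : 0 < α) {h g : ℝ → ℝ} (hh : Continuous h) (hg : Continuous g)
    (t : ℝ) : fracInt α (fun s => h s - g s) t = fracInt α h t - fracInt α g t := by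
  unfold fracInt
  rw [← mul_sub, ← intervalIntegral.integral_sub (intervalIntegrable_fracInt hα hh t)
    (intervalIntegrable_fracInt hα hg t)]
  simp_rw [mul_sub]

lemma fracInt_add {α : ℝ} (hα : 0 < α) {h g : ℝ → ℝ} (hh : Continuous h) (hg : Continuous g)
    (t : ℝ) : fracInt α (fun s => h s + g s) t = fracInt α h t + fracInt α g t := by
  unfold fracInt
  rw [← mul_add, ← intervalIntegral.integral_add (intervalIntegrable_fracInt hα hh t)
    (intervalIntegrable_fracInt hα hg t)]
  simp_rw [mul_add]

lemma fracInt_const_mul {α : ℝ} (c : ℝ) (h : ℝ → ℝ) (t : ℝ) :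
    fracInt α (fun s => c * h s) t = c * fracInt α h t := by
  unfold fracInt
  rw [mul_left_comm, ← intervalIntegral.integral_const_mul c]
  simp_rw [mul_left_comm]

lemma fracInt_scale {α : ℝ} (h : ℝ → ℝ) {c t : ℝ} (hc : 0 ≤ c) (ht : 0 ≤ t) :
    fracInt α h (c * t) = c ^ α * fracInt α (fun s => h (c * s)) t := by
  simp only [fracInt]
  rw [Real.mul_rpow hc ht, mul_assoc]
  simp_rw [mul_left_comm c]

lemma fracInt_eq_integral {α : ℝ} (h : ℝ → ℝ) {t : ℝ} (ht : 0 < t) :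
    fracInt α h t = ∫ s in (0:ℝ)..t, (t - s) ^ (α - 1) * h s := by
  have h1 := intervalIntegral.smul_integral_comp_mul_right (a := 0) (b := 1)
    (fun s => (t - s) ^ (α - 1) * h s) t
  rw [zero_mul, one_mul, smul_eq_mul] at h1
  rw [← h1, fracInt, ← intervalIntegral.integral_const_mul, ← intervalIntegral.integral_const_mul]
  refine intervalIntegral.integral_congr fun r hr => ?_
  rw [uIcc_of_le zero_le_one] at hr
  have e : t - r * t = t * (1 - r) := by ring
  have e2 : t ^ α = t * t ^ (α - 1) := by
    rw [Real.rpow_sub_one ht.ne']; field_simp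
  simp only [e]
  rw [Real.mul_rpow ht.le (sub_nonneg.2 hr.2), e2]
  ring

lemma fracInt_exp_le {α : ℝ} (hα : 0 < α) {lam : ℝ} (hlam : 0 < lam) {t : ℝ} (ht : 0 ≤ t) :
    fracInt α (fun s => Real.exp (lam * s)) t
      ≤ (1 / lam) ^ α * Real.Gamma α * Real.exp (lam * t) := by
  rcases ht.eq_or_lt with rfl | ht
  · simp only [fracInt, Real.zero_rpow hα.ne', zero_mul]
    have := Real.Gamma_pos_of_pos hα
    positivity
  have hI := Real.integral_rpow_mul_exp_neg_mul_Ioi hα hlam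
  have hint : IntegrableOn (fun u : ℝ => u ^ (α - 1) * Real.exp (-(lam * u))) (Ioi 0) := by
    by_contra hcon
    rw [integral_undef hcon] at hI
    have := Real.Gamma_pos_of_pos hα
    have : 0 < (1 / lam) ^ α * Real.Gamma α := by positivity
    linarith
  have h1 := intervalIntegral.integral_comp_sub_left (a := 0) (b := t)
    (fun u : ℝ => u ^ (α - 1) * Real.exp (lam * (t - u))) t
  rw [sub_self, sub_zero] at h1
  rw [fracInt_eq_integral _ ht]
  simp only [sub_sub_cancel] at h1
  rw [h1, ← hI]
  have h2 : ∀ u : ℝ, u ^ (α - 1) * Real.exp (lam * (t - u))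
      = u ^ (α - 1) * Real.exp (-(lam * u)) * Real.exp (lam * t) := fun u => by
    rw [mul_assoc, ← Real.exp_add]; ring_nf
  simp_rw [h2]
  rw [intervalIntegral.integral_mul_const]
  refine mul_le_mul_of_nonneg_right ?_ (Real.exp_pos _).le
  rw [intervalIntegral.integral_of_le ht.le]
  refine setIntegral_mono_set hint ?_ Ioc_subset_Ioi_self.eventuallyLE
  filter_upwards [ae_restrict_mem measurableSet_Ioi] with u hu
  have := Real.rpow_nonneg (le_of_lt hu) (α - 1)
  simp only [Pi.zero_apply]
  positivity

lemma exists_exp_rate {α : ℝ} (hα : 0 < α) (L Λ : ℝ) :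
    ∃ lam : ℝ, 0 < lam ∧ Λ ≤ lam ∧ L * ((1 / lam) ^ α * Real.Gamma α) ≤ 1 / 2 := by
  have h1 : Tendsto (fun lam : ℝ => L * ((1 / lam) ^ α * Real.Gamma α)) atTop
      (𝓝 (L * (0 * Real.Gamma α))) := by
    refine ((Tendsto.mul_const _ ?_).const_mul L)
    have := (tendsto_inv_atTop_zero (𝕜 := ℝ)).rpow_const (p := α) (Or.inr hα.le)
    simpa [Real.zero_rpow hα.ne'] using this
  rw [zero_mul, mul_zero] at h1
  have h2 := h1.eventually (ge_mem_nhds (show (0:ℝ) < 1 / 2 by norm_num))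
  obtain ⟨lam, hl, h0, hΛ⟩ := (h2.and ((eventually_gt_atTop 0).and (eventually_ge_atTop Λ))).exists
  exact ⟨lam, h0, hΛ, hl⟩

lemma exists_fractional_gronwall {α : ℝ} (hα : 0 < α) {L : ℝ} (hL : 0 ≤ L) (T : ℝ) (hT : 0 ≤ T) :
    ∃ C : ℝ, 0 < C ∧ ∀ (d : ℝ → ℝ) (η : ℝ), Continuous d →
      (∀ t ∈ Icc 0 T, |d t| ≤ η + L * fracInt α (fun s => |d s|) t) →
      ∀ t ∈ Icc 0 T, |d t| ≤ C * η := by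
  obtain ⟨lam, hlam, -, hle⟩ := exists_exp_rate hα L 0
  refine ⟨2 * Real.exp (lam * T), by positivity, fun d η hd hη => ?_⟩
  obtain ⟨t₀, ht₀, hmax⟩ := (isCompact_Icc (a := (0:ℝ)) (b := T)).exists_isMaxOn
    (nonempty_Icc.2 hT) (f := fun t => Real.exp (-(lam * t)) * |d t|) (by fun_prop)
  set m := Real.exp (-(lam * t₀)) * |d t₀| with hm
  have hbound : ∀ t ∈ Icc 0 T, |d t| ≤ m * Real.exp (lam * t) := fun t ht => by
    have h1 : Real.exp (-(lam * t)) * |d t| ≤ m := hmax ht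
    rw [Real.exp_neg, inv_mul_le_iff₀ (Real.exp_pos _)] at h1
    linarith
  have hm0 : 0 ≤ m := by positivity
  have hη0 : 0 ≤ η := by
    have h0 := hη 0 ⟨le_rfl, hT⟩
    simp only [fracInt, Real.zero_rpow hα.ne', zero_mul, mul_zero, add_zero] at h0
    exact (abs_nonneg _).trans h0
  have hkey : m ≤ η + m / 2 := by
    have h1 := hη t₀ ht₀
    have h2 : fracInt α (fun s => |d s|) t₀ ≤ m * fracInt α (fun s => Real.exp (lam * s)) t₀ := by
      rw [← fracInt_const_mul]
      exact fracInt_mono hα hd.abs (by fun_prop) ht₀.1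
        fun s hs => hbound s ⟨hs.1, hs.2.trans ht₀.2⟩
    have h3 := fracInt_exp_le hα hlam ht₀.1
    have h4 : |d t₀| ≤ η + m * (1 / 2) * Real.exp (lam * t₀) :=
      calc |d t₀| ≤ η + L * (m * ((1 / lam) ^ α * Real.Gamma α * Real.exp (lam * t₀))) := by
            refine h1.trans ?_
            gcongr
            exact h2.trans (by gcongr)
        _ = η + m * (L * ((1 / lam) ^ α * Real.Gamma α)) * Real.exp (lam * t₀) := by ring
        _ ≤ _ := by gcongr
    have h5 : η ≤ η * Real.exp (lam * t₀) :=
      le_mul_of_one_le_right hη0 (Real.one_le_exp (mul_nonneg hlam.le ht₀.1))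
    rw [hm, Real.exp_neg, inv_mul_le_iff₀ (Real.exp_pos _), ← Real.exp_neg, ← hm]
    linarith
  intro t ht
  calc |d t| ≤ m * Real.exp (lam * t) := hbound t ht
    _ ≤ (2 * η) * Real.exp (lam * T) := by
        gcongr
        · linarith
        · exact ht.2
    _ = _ := by ring

/-- Solvability of the Volterra equation `u = b - fracInt α (F · u)` in the class of functions of
exponential growth, for a nonlinearity that is Lipschitz in the unknown. -/
theorem exists_volterra_solution {α : ℝ} (hα : 0 < α) {b : ℝ → ℝ} (hb : Continuous b)
    {F : ℝ → ℝ → ℝ} (hF : Continuous (Function.uncurry F)) {L : ℝ} (hL : 0 ≤ L)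
    (hLip : ∀ s x y, |F s x - F s y| ≤ L * |x - y|) (hF0 : ∀ s, F s 0 = 0)
    {C Λ : ℝ} (hbC : ∀ t, 0 ≤ t → |b t| ≤ C * Real.exp (Λ * t)) :
    ∃ u : ℝ → ℝ, Continuous u ∧
      (∃ C' Λ' : ℝ, ∀ t, 0 ≤ t → |u t| ≤ C' * Real.exp (Λ' * t)) ∧
      ∀ t, 0 ≤ t → u t = b t - fracInt α (fun s => F s (u s)) t := by
  obtain ⟨lam, hlam, hΛ, hle⟩ := exists_exp_rate hα L Λ
  have hC : 0 ≤ C := by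
    have := (abs_nonneg _).trans (hbC 0 le_rfl)
    simpa using this
  have hFc : ∀ u : ℝ → ℝ, Continuous u → Continuous fun s => F s (u s) := fun u hu =>
    hF.comp (continuous_id.prodMk hu)
  have hexp : ∀ w : BoundedContinuousFunction ℝ ℝ, Continuous fun s => Real.exp (lam * s) * w s :=
    fun w => (by fun_prop : Continuous fun s => Real.exp (lam * s)).mul w.continuous
  have hdiff : ∀ (w z : BoundedContinuousFunction ℝ ℝ) (t : ℝ), 0 ≤ t →
      |fracInt α (fun s => F s (Real.exp (lam * s) * w s)) t
        - fracInt α (fun s => F s (Real.exp (lam * s) * z s)) t|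
      ≤ Real.exp (lam * t) * (1 / 2 * dist w z) := fun w z t ht => by
    have hw := hFc _ (hexp w)
    have hz := hFc _ (hexp z)
    rw [← fracInt_sub hα hw hz]
    calc _ ≤ fracInt α (fun s => (L * dist w z) * Real.exp (lam * s)) t := by
          refine abs_fracInt_le hα (hw.sub hz) (by fun_prop) ht fun s _ => (hLip _ _ _).trans ?_
          rw [← mul_sub, abs_mul, abs_of_pos (Real.exp_pos _), mul_assoc]
          have : |w s - z s| ≤ dist w z :=
            BoundedContinuousFunction.dist_coe_le_dist (f := w) (g := z) s
          calc L * (Real.exp (lam * s) * |w s - z s|)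
              ≤ L * (Real.exp (lam * s) * dist w z) := by gcongr
            _ = _ := by ring
      _ = (L * dist w z) * fracInt α (fun s => Real.exp (lam * s)) t := fracInt_const_mul _ _ _
      _ ≤ (L * dist w z) * ((1 / lam) ^ α * Real.Gamma α * Real.exp (lam * t)) := by
          gcongr
          exact fracInt_exp_le hα hlam ht
      _ = (L * ((1 / lam) ^ α * Real.Gamma α)) * (dist w z * Real.exp (lam * t)) := by ring
      _ ≤ 1 / 2 * (dist w z * Real.exp (lam * t)) := by gcongr
      _ = _ := by ring
  let Φ : BoundedContinuousFunction ℝ ℝ → ℝ → ℝ := fun w t =>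
    Real.exp (-(lam * max t 0)) *
      (b (max t 0) - fracInt α (fun s => F s (Real.exp (lam * s) * w s)) (max t 0))
  have hΦc : ∀ w, Continuous (Φ w) := fun w => by
    have hw := fracInt_continuous hα (hFc _ (hexp w))
    have hm : Continuous fun t : ℝ => max t 0 := by fun_prop
    exact (by fun_prop : Continuous fun t : ℝ => Real.exp (-(lam * max t 0))).mul
      ((hb.comp hm).sub (hw.comp hm))
  have hΦd : ∀ w z t, |Φ w t - Φ z t| ≤ 1 / 2 * dist w z := fun w z t => by
    have := hdiff z w (max t 0) (le_max_right _ _)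
    simp only [Φ]
    rw [← mul_sub, abs_mul, abs_of_pos (Real.exp_pos _), sub_sub_sub_cancel_left, Real.exp_neg,
      inv_mul_le_iff₀ (Real.exp_pos _), dist_comm w z]
    exact this
  have hΦ0 : ∀ t, |Φ 0 t| ≤ C := fun t => by
    have h0 : fracInt α (fun s => F s (Real.exp (lam * s) *
        (0 : BoundedContinuousFunction ℝ ℝ) s)) (max t 0) = 0 := by
      simp [fracInt, hF0]
    simp only [Φ]
    rw [h0, sub_zero, abs_mul, abs_of_pos (Real.exp_pos _), Real.exp_neg,
      inv_mul_le_iff₀ (Real.exp_pos _), mul_comm]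
    refine (hbC _ (le_max_right _ _)).trans ?_
    have := le_max_right t 0
    gcongr
  let Ψ : BoundedContinuousFunction ℝ ℝ → BoundedContinuousFunction ℝ ℝ := fun w =>
    BoundedContinuousFunction.ofNormedAddCommGroup (Φ w) (hΦc w) (C + 1 / 2 * dist w 0) fun t => by
      have h1 := hΦd w 0 t
      have h2 := hΦ0 t
      have h3 := abs_sub_abs_le_abs_sub (Φ w t) (Φ 0 t)
      rw [Real.norm_eq_abs]
      linarith
  have hΨ : ContractingWith (1 / 2) Ψ := by
    refine ⟨by norm_num, LipschitzWith.of_dist_le_mul fun w z => ?_⟩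
    refine (BoundedContinuousFunction.dist_le (by positivity)).2 fun t => ?_
    rw [Real.dist_eq]
    simpa [Ψ] using hΦd w z t
  obtain ⟨w, hw⟩ : ∃ w, Ψ w = w := ⟨_, hΨ.fixedPoint_isFixedPt⟩
  refine ⟨fun t => Real.exp (lam * t) * w t, hexp w, ⟨‖w‖, lam, fun t _ => ?_⟩, fun t ht => ?_⟩
  · rw [abs_mul, abs_of_pos (Real.exp_pos _), mul_comm]
    have : |w t| ≤ ‖w‖ := w.norm_coe_le_norm t
    gcongr
  · have h1 : w t = Φ w t := by
      conv_lhs => rw [← hw]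
      rfl
    beta_reduce
    conv_lhs => rw [h1]
    simp only [Φ, max_eq_left ht]
    rw [← mul_assoc, ← Real.exp_add, add_neg_cancel, Real.exp_zero, one_mul]

/-- Solutions of the Volterra equation are differentiable under dilations: the derivative of
`c ↦ E (c * t)` at `c = 1` is the solution `v` of the linearized equation, uniformly in `t`. -/
lemma volterra_dilation_estimate {α : ℝ} (hα : 0 < α) {f f' E v : ℝ → ℝ} {L : ℝ}
    (hfc : Continuous f) (hf'c : Continuous f') (hf'L : ∀ x, |f' x| ≤ L)
    (hunif : ∀ ε > 0, ∃ δ > 0, ∀ x y, |x - y| < δ → |f x - f y - f' y * (x - y)| ≤ ε * |x - y|)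
    (hE : Continuous E) (hv : Continuous v)
    (hEeq : ∀ t, 0 ≤ t → E t = 1 - fracInt α (fun s => f (E s)) t)
    (hveq : ∀ t, 0 ≤ t → v t = α * (E t - 1) - fracInt α (fun s => f' (E s) * v s) t)
    {T : ℝ} (hT : 0 ≤ T) {ε : ℝ} (hε : 0 < ε) :
    ∀ᶠ c in 𝓝 (1:ℝ), ∀ t ∈ Icc 0 T, |E (c * t) - E t - (c - 1) * v t| ≤ ε * |c - 1| := by
  have hL : 0 ≤ L := (abs_nonneg _).trans (hf'L 0)
  obtain ⟨C, hC, hgron⟩ := exists_fractional_gronwall hα (L := L + 1) (by linarith) T hT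
  obtain ⟨V₁, hV₁⟩ := (isCompact_Icc (a := (0:ℝ)) (b := 2 * T)).exists_bound_of_continuousOn
    hE.continuousOn
  obtain ⟨V₂, hV₂⟩ := (isCompact_Icc (a := (0:ℝ)) (b := 2 * T)).exists_bound_of_continuousOn
    hv.continuousOn
  have hV₁0 : 0 ≤ V₁ := (norm_nonneg _).trans (hV₁ 0 ⟨le_rfl, by linarith⟩)
  have hV₂0 : 0 ≤ V₂ := (norm_nonneg _).trans (hV₂ 0 ⟨le_rfl, by linarith⟩)
  set M := (V₁ + 1) + α + V₂ * T ^ α / α with hM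
  have hM0 : 0 < M := by positivity
  obtain ⟨κ, hκ, hκ1, hκε⟩ : ∃ κ : ℝ, 0 < κ ∧ κ ≤ 1 ∧ C * (κ * M) ≤ ε := by
    refine ⟨min 1 (ε / (C * M)), by positivity, min_le_left _ _, ?_⟩
    calc C * (min 1 (ε / (C * M)) * M) ≤ C * (ε / (C * M) * M) := by
          gcongr
          exact min_le_right _ _
      _ = ε := by field_simp
  obtain ⟨δ, hδ, hfδ⟩ := hunif κ hκ
  obtain ⟨δ', hδ', hEδ⟩ := Metric.uniformContinuousOn_iff.1
    ((isCompact_Icc (a := (0:ℝ)) (b := 2 * T)).uniformContinuousOn_of_continuous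
      hE.continuousOn) (min κ δ) (lt_min hκ hδ)
  have hpow : ∀ᶠ c in 𝓝 (1:ℝ), |c ^ (-α) - 1 + α * (c - 1)| ≤ κ * |c - 1| := by
    have h := (Real.hasDerivAt_rpow_const (x := 1) (p := -α) (Or.inl one_ne_zero)).isLittleO
    have h2 := h.def hκ
    filter_upwards [h2] with c hc
    simp only [Real.one_rpow, smul_eq_mul, Real.norm_eq_abs] at hc
    convert hc using 2
    ring
  have hnear : ∀ᶠ c in 𝓝 (1:ℝ), |c - 1| < min 1 (δ' / (T + 1)) := by
    have := Metric.ball_mem_nhds (1:ℝ) (show 0 < min 1 (δ' / (T + 1)) by positivity)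
    filter_upwards [this] with c hc
    rwa [Metric.mem_ball, Real.dist_eq] at hc
  filter_upwards [hpow, hnear] with c hc hcn
  have hc1 := abs_lt.1 (hcn.trans_le (min_le_left _ _))
  have hc2 : |c - 1| * (T + 1) < δ' := (lt_div_iff₀ (by linarith)).1 (hcn.trans_le (min_le_right _ _))
  have hc0 : 0 < c := by linarith [hc1.1]
  have hmem : ∀ t ∈ Icc 0 T, c * t ∈ Icc 0 (2 * T) ∧ t ∈ Icc 0 (2 * T) := fun t ht => by
    refine ⟨⟨mul_nonneg hc0.le ht.1, ?_⟩, ht.1, by linarith [ht.2]⟩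
    nlinarith [hc1.2, ht.1, ht.2]
  have hEc : ∀ t ∈ Icc 0 T, |E (c * t) - E t| < min κ δ := fun t ht => by
    have := hEδ _ (hmem t ht).1 _ (hmem t ht).2 (by
      rw [Real.dist_eq, ← sub_one_mul, abs_mul, abs_of_nonneg ht.1]
      nlinarith [abs_nonneg (c - 1), ht.2])
    rwa [Real.dist_eq] at this
  set d : ℝ → ℝ := fun t => E (c * t) - E t - (c - 1) * v t with hd
  have hdc : Continuous d := by fun_prop
  have hbd : ∀ t ∈ Icc 0 T, |d t| ≤ |c - 1| * (κ * M) + (L + 1) * fracInt α (fun s => |d s|) t := by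
    intro t ht
    set g : ℝ → ℝ := fun s => f (E (c * s)) - f (E s) - (c - 1) * (f' (E s) * v s) with hg
    have hgc : Continuous g := by fun_prop
    have hdeq : d t = -(c ^ (-α) - 1 + α * (c - 1)) * (E (c * t) - 1)
        + (c - 1) * α * (E (c * t) - E t) - fracInt α g t := by
      have h1 := hEeq (c * t) (mul_nonneg hc0.le ht.1)
      rw [fracInt_scale _ hc0.le ht.1] at h1
      have h2 := hEeq t ht.1
      have h3 := hveq t ht.1
      have h4 : fracInt α g t = fracInt α (fun s => f (E (c * s))) t
          - fracInt α (fun s => f (E s)) t - (c - 1) * fracInt α (fun s => f' (E s) * v s) t := by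
        rw [hg, fracInt_sub hα (by fun_prop) (by fun_prop), fracInt_sub hα (by fun_prop)
          (by fun_prop), fracInt_const_mul]
      have h5 : fracInt α (fun s => f (E (c * s))) t = c ^ (-α) * (1 - E (c * t)) := by
        rw [h1, Real.rpow_neg hc0.le]
        have := (Real.rpow_pos_of_pos hc0 α).ne'
        field_simp
        ring
      rw [h4, h5, show fracInt α (fun s => f (E s)) t = 1 - E t by linarith,
        show fracInt α (fun s => f' (E s) * v s) t = α * (E t - 1) - v t by linarith, hd]
      ring
    have hgle : |fracInt α g t| ≤ (L + 1) * fracInt α (fun s => |d s|) t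
        + |c - 1| * (κ * (V₂ * T ^ α / α)) := by
      have h1 : |fracInt α g t| ≤ fracInt α (fun s => (L + 1) * |d s| + κ * |c - 1| * V₂) t := by
        refine abs_fracInt_le hα hgc (by fun_prop) ht.1 fun s hs => ?_
        have hs' : s ∈ Icc 0 T := ⟨hs.1, hs.2.trans ht.2⟩
        have a1 := hfδ (E (c * s)) (E s) ((hEc s hs').trans_le (min_le_right _ _))
        have a2 : |v s| ≤ V₂ := hV₂ s (hmem s hs').2
        have a3 : g s = (f (E (c * s)) - f (E s) - f' (E s) * (E (c * s) - E s))
            + f' (E s) * d s := by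
          simp only [hg, hd]; ring
        have a4 : |E (c * s) - E s| ≤ |d s| + |c - 1| * V₂ := by
          have : E (c * s) - E s = d s + (c - 1) * v s := by simp only [hd]; ring
          rw [this]
          refine (abs_add_le _ _).trans ?_
          rw [abs_mul (c - 1)]
          gcongr
        rw [a3]
        calc _ ≤ _ := abs_add_le _ _
          _ ≤ κ * (|d s| + |c - 1| * V₂) + L * |d s| := by
            rw [abs_mul (f' (E s))]
            gcongr
            · exact a1.trans (by gcongr)
            · exact hf'L _
          _ ≤ 1 * |d s| + κ * (|c - 1| * V₂) + L * |d s| := by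
            rw [mul_add]
            gcongr
          _ = _ := by ring
      rw [fracInt_add hα (by fun_prop) (by fun_prop), fracInt_const_mul, fracInt_const hα] at h1
      refine h1.trans ?_
      have : t ^ α ≤ T ^ α := Real.rpow_le_rpow ht.1 ht.2 hα.le
      have : t ^ α * (κ * |c - 1| * V₂) / α ≤ T ^ α * (κ * |c - 1| * V₂) / α := by gcongr
      calc _ ≤ _ := add_le_add_right this _
        _ = _ := by ring
    rw [hdeq]
    have b1 : |E (c * t) - 1| ≤ V₁ + 1 := by
      have h1 : |E (c * t)| ≤ V₁ := hV₁ _ (hmem t ht).1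
      calc _ ≤ |E (c * t)| + |(1:ℝ)| := abs_sub _ _
        _ ≤ _ := by rw [abs_one]; gcongr
    have b2 : |E (c * t) - E t| ≤ κ := ((hEc t ht).trans_le (min_le_left _ _)).le
    calc _ ≤ |-(c ^ (-α) - 1 + α * (c - 1)) * (E (c * t) - 1)|
          + |(c - 1) * α * (E (c * t) - E t)| + |fracInt α g t| :=
          (abs_sub _ _).trans (add_le_add_left (abs_add_le _ _) _)
      _ ≤ (κ * |c - 1|) * (V₁ + 1) + |c - 1| * α * κ + ((L + 1) * fracInt α (fun s => |d s|) t
        + |c - 1| * (κ * (V₂ * T ^ α / α))) := by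
          rw [abs_mul, abs_neg, abs_mul, abs_mul (c - 1), abs_of_pos hα]
          gcongr
      _ = _ := by rw [hM]; ring
  intro t ht
  calc |d t| ≤ C * (|c - 1| * (κ * M)) := hgron d _ hdc hbd t ht
    _ = (C * (κ * M)) * |c - 1| := by ring
    _ ≤ _ := by gcongr

/-- Solvability of `E = 1 - fracInt α (f ∘ E)`, with regularity: `E` is differentiable on `(0,∞)`
and `t E'(t)` extends to a continuous function that is `O(t^α)` at the origin. -/
theorem exists_differentiable_volterra_solution {α : ℝ} (hα : 0 < α) {f f' : ℝ → ℝ} {L : ℝ}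
    (hfc : Continuous f) (hf'c : Continuous f') (hf'L : ∀ x, |f' x| ≤ L)
    (hLip : ∀ x y, |f x - f y| ≤ L * |x - y|)
    (hunif : ∀ ε > 0, ∃ δ > 0, ∀ x y, |x - y| < δ → |f x - f y - f' y * (x - y)| ≤ ε * |x - y|)
    (hf0 : f 0 = 0) :
    ∃ E v : ℝ → ℝ, Continuous E ∧ Continuous v ∧
      (∀ t, 0 ≤ t → E t = 1 - fracInt α (fun s => f (E s)) t) ∧
      (∀ t, 0 < t → HasDerivAt E (v t / t) t) ∧
      ∀ T, ∃ C, 0 ≤ C ∧ ∀ t ∈ Icc 0 T, |v t| ≤ C * t ^ α := by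
  have hL : 0 ≤ L := (abs_nonneg _).trans (hf'L 0)
  obtain ⟨E, hE, ⟨C, Λ, hEC⟩, hEeq⟩ := exists_volterra_solution hα (b := fun _ => 1)
    continuous_const (F := fun _ x => f x) (by fun_prop) hL (fun _ => hLip) (fun _ => hf0)
    (C := 1) (Λ := 0) (by simp)
  obtain ⟨v, hv, -, hveq⟩ := exists_volterra_solution hα (b := fun t => α * (E t - 1))
    (by fun_prop) (F := fun s x => f' (E s) * x) (by fun_prop) hL
    (fun s x y => by
      rw [← mul_sub, abs_mul]
      exact mul_le_mul_of_nonneg_right (hf'L _) (abs_nonneg _)) (fun s => mul_zero _)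
    (C := α * (C + 1)) (Λ := max Λ 0) (fun t ht => by
      have h1 := hEC t ht
      have h2 : Real.exp (Λ * t) ≤ Real.exp (max Λ 0 * t) := by
        gcongr
        exact le_max_left _ _
      have h3 : 1 ≤ Real.exp (max Λ 0 * t) :=
        Real.one_le_exp (mul_nonneg (le_max_right _ _) ht)
      have hC : 0 ≤ C := by
        have := (abs_nonneg _).trans (hEC 0 le_rfl)
        simpa using this
      rw [abs_mul, abs_of_pos hα, mul_assoc]
      gcongr
      calc |E t - 1| ≤ |E t| + |(1:ℝ)| := abs_sub _ _
        _ ≤ C * Real.exp (max Λ 0 * t) + 1 * Real.exp (max Λ 0 * t) := by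
          rw [abs_one, one_mul]
          gcongr
          exact h1.trans (by gcongr)
        _ = _ := by ring)
  refine ⟨E, v, hE, hv, hEeq, fun t ht => ?_, fun T => ?_⟩
  · have h1 : HasDerivAt (fun c => E (c * t)) (v t) 1 := by
      rw [hasDerivAt_iff_isLittleO, Asymptotics.isLittleO_iff]
      intro ε hε
      filter_upwards [volterra_dilation_estimate hα hfc hf'c hf'L hunif hE hv hEeq hveq ht.le hε]
        with c hc
      simpa using hc t ⟨ht.le, le_rfl⟩
    have h2 : HasDerivAt (fun s : ℝ => s / t) (1 / t) t := (hasDerivAt_id t).div_const t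
    have h3 : HasDerivAt (fun c => E (c * t)) (v t) (t / t) := by rwa [div_self ht.ne']
    have h4 := HasDerivAt.comp (h := fun s : ℝ => s / t) t h3 h2
    have h5 : (fun c => E (c * t)) ∘ (fun s : ℝ => s / t) = E := by
      ext s
      simp [div_mul_cancel₀ s ht.ne']
    rwa [h5, mul_one_div] at h4
  · have hc1 : Continuous fun s => f (E s) := by fun_prop
    have hc2 : Continuous fun s => f' (E s) * v s := by fun_prop
    obtain ⟨M₁, hM₁⟩ := (isCompact_Icc (a := (0:ℝ)) (b := T)).exists_bound_of_continuousOn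
      hc1.continuousOn
    obtain ⟨M₂, hM₂⟩ := (isCompact_Icc (a := (0:ℝ)) (b := T)).exists_bound_of_continuousOn
      hc2.continuousOn
    refine ⟨max M₁ 0 + max M₂ 0 / α, by positivity, fun t ht => ?_⟩
    have b1 : |fracInt α (fun s => f (E s)) t| ≤ t ^ α * max M₁ 0 / α := by
      rw [← fracInt_const hα]
      exact abs_fracInt_le hα hc1 continuous_const ht.1 fun s hs =>
        (hM₁ s ⟨hs.1, hs.2.trans ht.2⟩).trans (le_max_left _ _)
    have b2 : |fracInt α (fun s => f' (E s) * v s) t| ≤ t ^ α * max M₂ 0 / α := by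
      rw [← fracInt_const hα]
      exact abs_fracInt_le hα hc2 continuous_const ht.1 fun s hs =>
        (hM₂ s ⟨hs.1, hs.2.trans ht.2⟩).trans (le_max_left _ _)
    rw [hveq t ht.1, show E t - 1 = -fracInt α (fun s => f (E s)) t by linarith [hEeq t ht.1]]
    calc _ ≤ α * (t ^ α * max M₁ 0 / α) + t ^ α * max M₂ 0 / α := by
          refine (abs_sub _ _).trans ?_
          rw [abs_mul, abs_neg, abs_of_pos hα]
          gcongr
      _ = _ := by field_simp

lemma integral_beta_unit {p q : ℝ} (hp : 0 < p) (hq : 0 < q) :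
    IntervalIntegrable (fun r : ℝ => r ^ (p - 1) * (1 - r) ^ (q - 1)) volume 0 1 ∧
      ∫ r in (0:ℝ)..1, r ^ (p - 1) * (1 - r) ^ (q - 1) = ProbabilityTheory.beta p q := by
  have hcongr : ∀ r ∈ Ioc (0:ℝ) 1, ((r : ℂ) ^ ((p : ℂ) - 1) * (1 - (r : ℂ)) ^ ((q : ℂ) - 1))
      = ((r ^ (p - 1) * (1 - r) ^ (q - 1) : ℝ) : ℂ) := fun r hr => by
    rw [Complex.ofReal_mul, Complex.ofReal_cpow hr.1.le, Complex.ofReal_cpow (sub_nonneg.2 hr.2)]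
    push_cast
    rfl
  constructor
  · have h := (Complex.betaIntegral_convergent (u := p) (v := q) (by simpa) (by simpa)).norm
    refine h.congr fun r hr => ?_
    rw [uIoc_of_le zero_le_one] at hr
    rw [hcongr r hr, Complex.norm_real, Real.norm_of_nonneg]
    exact mul_nonneg (Real.rpow_nonneg hr.1.le _) (Real.rpow_nonneg (sub_nonneg.2 hr.2) _)
  · rw [ProbabilityTheory.beta_eq_betaIntegralReal p q hp hq, Complex.betaIntegral,
      intervalIntegral.integral_of_le zero_le_one, intervalIntegral.integral_of_le zero_le_one,
      setIntegral_congr_fun measurableSet_Ioc hcongr, integral_complex_ofReal]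
    rfl

lemma integral_beta_interval {p q : ℝ} (hp : 0 < p) (hq : 0 < q) {a b : ℝ} (hab : a < b) :
    IntervalIntegrable (fun s : ℝ => (b - s) ^ (p - 1) * (s - a) ^ (q - 1)) volume a b ∧
      ∫ s in a..b, (b - s) ^ (p - 1) * (s - a) ^ (q - 1)
        = (b - a) ^ (p + q - 1) * ProbabilityTheory.beta p q := by
  obtain ⟨hI, hv⟩ := integral_beta_unit hq hp
  have hpos : 0 < b - a := sub_pos.2 hab
  have hcongr : ∀ s ∈ Icc a b, (b - a) ^ (p + q - 2) *
      (((b - a)⁻¹ * (s - a)) ^ (q - 1) * (1 - (b - a)⁻¹ * (s - a)) ^ (p - 1))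
      = (b - s) ^ (p - 1) * (s - a) ^ (q - 1) := fun s hs => by
    have e : 1 - (b - a)⁻¹ * (s - a) = (b - a)⁻¹ * (b - s) := by field_simp; ring
    rw [e, Real.mul_rpow (inv_nonneg.2 hpos.le) (sub_nonneg.2 hs.1),
      Real.mul_rpow (inv_nonneg.2 hpos.le) (sub_nonneg.2 hs.2), Real.inv_rpow hpos.le,
      Real.inv_rpow hpos.le, show p + q - 2 = (q - 1) + (p - 1) by ring, Real.rpow_add hpos]
    have h1 := (Real.rpow_pos_of_pos hpos (q - 1)).ne'
    have h2 := (Real.rpow_pos_of_pos hpos (p - 1)).ne'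
    field_simp
  constructor
  · have h1 := ((hI.comp_mul_left (c := (b - a)⁻¹)).comp_sub_right a).const_mul
      ((b - a) ^ (p + q - 2))
    have e : 1 / (b - a)⁻¹ + a = b := by simp
    rw [zero_div, zero_add, e] at h1
    refine h1.congr fun s hs => ?_
    rw [uIoc_of_le hab.le] at hs
    exact hcongr s ⟨hs.1.le, hs.2⟩
  · have h1 := intervalIntegral.integral_comp_sub_right (a := a) (b := b)
      (fun x : ℝ => ((b - a)⁻¹ * x) ^ (q - 1) * (1 - (b - a)⁻¹ * x) ^ (p - 1)) a
    have h2 := intervalIntegral.integral_comp_mul_left (a := 0) (b := b - a)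
      (fun x : ℝ => x ^ (q - 1) * (1 - x) ^ (p - 1)) (inv_ne_zero hpos.ne')
    rw [sub_self, h2, mul_zero, inv_mul_cancel₀ hpos.ne', hv, inv_inv, smul_eq_mul] at h1
    rw [← intervalIntegral.integral_congr (g := fun s : ℝ => (b - s) ^ (p - 1) * (s - a) ^ (q - 1))
      (by rw [uIcc_of_le hab.le]; exact hcongr), intervalIntegral.integral_const_mul, h1,
      show p + q - 1 = (p + q - 2) + 1 by ring, Real.rpow_add_one hpos.ne',
      ProbabilityTheory.beta, ProbabilityTheory.beta, add_comm q p]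
    ring

/-- Semigroup property of the Riemann-Liouville integrals, in the range where the composed kernel
is bounded. -/
theorem integral_rpow_integral_rpow {p q : ℝ} (hp : 0 < p) (hq : 0 < q) (hpq : 1 ≤ p + q)
    {φ : ℝ → ℝ} {t : ℝ} (ht : 0 < t) (hφ : IntegrableOn φ (Ioc 0 t)) :
    ∫ s in (0:ℝ)..t, (t - s) ^ (p - 1) * ∫ r in (0:ℝ)..s, (s - r) ^ (q - 1) * φ r
      = ProbabilityTheory.beta p q * ∫ r in (0:ℝ)..t, (t - r) ^ (p + q - 1) * φ r := by
  set k : ℝ → ℝ → ℝ := fun s r =>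
    (Ioi r).indicator (fun s => (t - s) ^ (p - 1) * (s - r) ^ (q - 1)) s with hk
  set μ := (volume : Measure ℝ).restrict (Ioc 0 t) with hμ
  have hset : ∀ r ∈ Ioc 0 t, Ioc 0 t ∩ Ioi r = Ioc r t := fun r hr => by
    ext s
    simp only [mem_inter_iff, mem_Ioc, mem_Ioi]
    exact ⟨fun h => ⟨h.2, h.1.2⟩, fun h => ⟨⟨hr.1.trans h.1, h.2⟩, h.1⟩⟩
  have hkint : ∀ r ∈ Ioo 0 t, Integrable (fun s => k s r) μ := fun r hr => by
    rw [hμ, ← IntegrableOn]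
    rw [hk, ← integrable_indicator_iff measurableSet_Ioc, indicator_indicator,
      hset r ⟨hr.1, hr.2.le⟩, integrable_indicator_iff measurableSet_Ioc,
      ← intervalIntegrable_iff_integrableOn_Ioc_of_le hr.2.le]
    exact (integral_beta_interval hp hq hr.2).1
  have hkval : ∀ r ∈ Ioo 0 t, ∫ s, k s r ∂μ = (t - r) ^ (p + q - 1) * ProbabilityTheory.beta p q :=
    fun r hr => by
      rw [hμ, hk, setIntegral_indicator measurableSet_Ioi, hset r ⟨hr.1, hr.2.le⟩,
        ← intervalIntegral.integral_of_le hr.2.le]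
      exact (integral_beta_interval hp hq hr.2).2
  have hk0 : ∀ s ∈ Ioc 0 t, ∀ r, 0 ≤ k s r := fun s hs r => by
    refine indicator_apply_nonneg fun h => ?_
    exact mul_nonneg (Real.rpow_nonneg (sub_nonneg.2 hs.2) _)
      (Real.rpow_nonneg (sub_nonneg.2 (le_of_lt h)) _)
  have hae : ∀ᵐ r ∂μ, r ∈ Ioo 0 t := by
    rw [hμ, ← restrict_Ioo_eq_restrict_Ioc]
    exact ae_restrict_mem measurableSet_Ioo
  have hkm : Measurable (Function.uncurry k) := by
    have : Function.uncurry k = {z : ℝ × ℝ | z.2 < z.1}.indicator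
        (fun z => (t - z.1) ^ (p - 1) * (z.1 - z.2) ^ (q - 1)) := by
      ext ⟨s, r⟩
      simp [k, indicator_apply]
    rw [this]
    exact Measurable.indicator (by fun_prop) (measurableSet_lt measurable_snd measurable_fst)
  have hcont : ContinuousOn (fun r : ℝ => (t - r) ^ (p + q - 1)) (Icc 0 t) :=
    ContinuousOn.rpow_const (by fun_prop) fun r _ => Or.inr (by linarith)
  have hbd : Integrable (fun r => (t - r) ^ (p + q - 1) * φ r) μ := by
    have h1 : IntegrableOn φ (Icc 0 t) := (integrableOn_Icc_iff_integrableOn_Ioc).2 hφ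
    exact ((h1.continuousOn_mul hcont isCompact_Icc).mono_set Ioc_subset_Icc_self)
  have hGm : AEStronglyMeasurable (fun z : ℝ × ℝ => k z.1 z.2 * φ z.2) (μ.prod μ) :=
    hkm.aestronglyMeasurable.mul
      (hφ.aestronglyMeasurable.comp_quasiMeasurePreserving Measure.quasiMeasurePreserving_snd)
  have hG : Integrable (fun z : ℝ × ℝ => k z.1 z.2 * φ z.2) (μ.prod μ) := by
    rw [integrable_prod_iff' hGm]
    refine ⟨?_, ?_⟩
    · filter_upwards [hae] with r hr
      exact (hkint r hr).mul_const _
    · refine (hbd.norm.mul_const (ProbabilityTheory.beta p q)).congr ?_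
      filter_upwards [hae] with r hr
      have : ∀ᵐ s ∂μ, ‖k s r * φ r‖ = k s r * ‖φ r‖ := by
        filter_upwards [ae_restrict_mem measurableSet_Ioc] with s hs
        rw [norm_mul, Real.norm_of_nonneg (hk0 s hs r)]
      rw [integral_congr_ae this, MeasureTheory.integral_mul_const, hkval r hr, norm_mul,
        Real.norm_of_nonneg (Real.rpow_nonneg (sub_nonneg.2 hr.2.le) _)]
      ring
  have hswap := integral_integral_swap (f := fun s r => k s r * φ r) hG
  rw [intervalIntegral.integral_of_le ht.le, intervalIntegral.integral_of_le ht.le,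
    ← MeasureTheory.integral_const_mul]
  refine Eq.trans ?_ (hswap.trans ?_)
  · refine setIntegral_congr_fun measurableSet_Ioc fun s hs => ?_
    rw [intervalIntegral.integral_of_le hs.1.le, ← MeasureTheory.integral_const_mul, hμ,
      ← restrict_Ioo_eq_restrict_Ioc (a := (0:ℝ)) (b := s)]
    have h1 : ∀ r, k s r * φ r
        = (Iio s).indicator (fun r => (t - s) ^ (p - 1) * ((s - r) ^ (q - 1) * φ r)) r := fun r => by
      simp only [hk, indicator_apply, mem_Ioi, mem_Iio]
      split_ifs <;> ring
    simp_rw [h1]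
    rw [setIntegral_indicator measurableSet_Iio]
    congr 2
    ext r
    simp only [mem_inter_iff, mem_Ioc, mem_Iio, mem_Ioo]
    exact ⟨fun h => ⟨⟨h.1, h.2.le.trans hs.2⟩, h.2⟩, fun h => ⟨h.1.1, h.2⟩⟩
  · refine integral_congr_ae ?_
    filter_upwards [hae] with r hr
    rw [MeasureTheory.integral_mul_const, hkval r hr]
    ring

lemma continuousAt_fracInt_of_singular {β α C T : ℝ} (hβ : 0 < β) (hα : 0 < α) (hα1 : α < 1)
    (hC : 0 ≤ C) {φ : ℝ → ℝ} (hm : Measurable φ) (hφ : ∀ t, 0 < t → ContinuousAt φ t)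
    (hb : ∀ s ∈ Ioc 0 T, |φ s| ≤ C * s ^ (α - 1)) {t₀ : ℝ} (ht₀ : 0 < t₀) (hT : t₀ < T) :
    ContinuousAt (fracInt β φ) t₀ := by
  refine (Real.continuous_rpow_const hβ.le).continuousAt.mul ?_
  refine intervalIntegral.continuousAt_of_dominated_interval
    (bound := fun r => (C * (t₀ / 2) ^ (α - 1)) * (r ^ (α - 1) * (1 - r) ^ (β - 1))) ?_ ?_ ?_ ?_
  · exact Eventually.of_forall fun t => Measurable.aestronglyMeasurable (by fun_prop)
  · filter_upwards [Ioo_mem_nhds (half_lt_self ht₀) hT] with t ht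
    refine Eventually.of_forall fun r hr => ?_
    rw [uIoc_of_le zero_le_one] at hr
    have ht0 : 0 < t := (half_pos ht₀).trans ht.1
    have h1 := Real.rpow_nonneg (sub_nonneg.2 hr.2) (β - 1)
    have h2 : |φ (r * t)| ≤ C * (r * t) ^ (α - 1) :=
      hb _ ⟨mul_pos hr.1 ht0, (mul_le_of_le_one_left ht0.le hr.2).trans ht.2.le⟩
    have h3 : t ^ (α - 1) ≤ (t₀ / 2) ^ (α - 1) :=
      Real.rpow_le_rpow_of_nonpos (half_pos ht₀) ht.1.le (by linarith)
    have h4 := Real.rpow_nonneg hr.1.le (α - 1)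
    rw [norm_mul, Real.norm_of_nonneg h1, Real.norm_eq_abs]
    calc _ ≤ (1 - r) ^ (β - 1) * (C * (r ^ (α - 1) * (t₀ / 2) ^ (α - 1))) := by
          rw [Real.mul_rpow hr.1.le ht0.le] at h2
          gcongr
          exact h2.trans (by gcongr)
      _ = _ := by ring
  · exact (integral_beta_unit hα hβ).1.const_mul _
  · refine Eventually.of_forall fun r hr => ?_
    rw [uIoc_of_le zero_le_one] at hr
    refine ContinuousAt.mul continuousAt_const ?_
    exact ContinuousAt.comp (f := fun t => r * t) (hφ _ (mul_pos hr.1 ht₀)) (by fun_prop)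

/-- A solution of the Volterra equation with the natural singularity of the derivative at the
origin solves the corresponding Caputo equation. -/
theorem caputo_of_volterra {α : ℝ} (hα : 0 < α) (hα1 : α < 1) {E v h : ℝ → ℝ}
    (hE : Continuous E) (hv : Continuous v) (hh : Continuous h)
    (hEeq : ∀ t, 0 ≤ t → E t = 1 - fracInt α h t)
    (hder : ∀ t, 0 < t → HasDerivAt E (v t / t) t)
    (hvb : ∀ T, ∃ C, 0 ≤ C ∧ ∀ t ∈ Icc 0 T, |v t| ≤ C * t ^ α) {t : ℝ} (ht : 0 < t) :
    IntegrableOn (fun s => deriv E s * (t - s) ^ (-α)) (Ioc 0 t) ∧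
      ∫ s in (0:ℝ)..t, deriv E s * (t - s) ^ (-α) = -(ProbabilityTheory.beta (1 - α) α * h t) := by
  set φ : ℝ → ℝ := fun s => v s / s with hφ
  have hα' : 0 < 1 - α := by linarith
  have hneg : -α = 1 - α - 1 := by ring
  have hm : Measurable φ := by fun_prop
  have hφc : ∀ t, 0 < t → ContinuousAt φ t := fun t ht =>
    hv.continuousAt.div continuousAt_id ht.ne'
  have hb : ∀ T, ∃ C, 0 ≤ C ∧ ∀ s ∈ Ioc 0 T, |φ s| ≤ C * s ^ (α - 1) := fun T => by
    obtain ⟨C, hC, h⟩ := hvb T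
    refine ⟨C, hC, fun s hs => ?_⟩
    rw [hφ, abs_div, abs_of_pos hs.1, Real.rpow_sub_one hs.1.ne', ← mul_div_assoc]
    have := hs.1
    gcongr
    exact h s ⟨hs.1.le, hs.2⟩
  have hφint : ∀ t, 0 < t → IntegrableOn φ (Ioc 0 t) := fun t ht => by
    obtain ⟨C, hC, h⟩ := hb t
    have h1 := (intervalIntegrable_rpow' (a := 0) (b := t) (r := α - 1) (by linarith)).const_mul C
    rw [intervalIntegrable_iff_integrableOn_Ioc_of_le ht.le] at h1
    refine Integrable.mono' h1 hm.aestronglyMeasurable ?_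
    filter_upwards [ae_restrict_mem measurableSet_Ioc] with s hs using h s hs
  have hE0 : E 0 = 1 := by
    rw [hEeq 0 le_rfl]
    simp [fracInt, Real.zero_rpow hα.ne']
  have hFTC : ∀ t, 0 < t → ∫ s in (0:ℝ)..t, φ s = E t - 1 := fun t ht => by
    rw [← hE0]
    refine intervalIntegral.integral_eq_sub_of_hasDerivAt_of_le ht.le hE.continuousOn
      (fun s hs => hder s hs.1) ?_
    rw [intervalIntegrable_iff_integrableOn_Ioc_of_le ht.le]
    exact hφint t ht
  have hdom : ∀ t C, 0 < t → (∀ s ∈ Ioc 0 t, |φ s| ≤ C * s ^ (α - 1)) → ∀ s ∈ Ioc 0 t,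
      ‖(t - s) ^ (1 - α - 1) * φ s‖ ≤ C * ((t - s) ^ (1 - α - 1) * (s - 0) ^ (α - 1)) :=
    fun t C _ h s hs => by
      have h1 := Real.rpow_nonneg (sub_nonneg.2 hs.2) (1 - α - 1)
      rw [norm_mul, Real.norm_of_nonneg h1, sub_zero, mul_left_comm]
      exact mul_le_mul_of_nonneg_left (h s hs) h1
  set H := fracInt (1 - α) φ with hH
  have hHeq : ∀ t, 0 < t → H t = ∫ s in (0:ℝ)..t, (t - s) ^ (1 - α - 1) * φ s :=
    fun t ht => fracInt_eq_integral φ ht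
  have hHc : ∀ t, 0 < t → ContinuousAt H t := fun t ht => by
    obtain ⟨C, hC, h⟩ := hb (t + 1)
    exact continuousAt_fracInt_of_singular hα' hα hα1 hC hm hφc h ht (by linarith)
  have hHint : ∀ t, 0 < t → IntervalIntegrable H volume 0 t := fun t ht => by
    obtain ⟨C, hC, h⟩ := hb t
    rw [intervalIntegrable_iff_integrableOn_Ioc_of_le ht.le]
    refine Integrable.mono' (integrableOn_const (C := C * ProbabilityTheory.beta (1 - α) α)
      measure_Ioc_lt_top.ne)
      (ContinuousOn.aestronglyMeasurable
        (fun s hs => (hHc s hs.1).continuousWithinAt) measurableSet_Ioc) ?_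
    filter_upwards [ae_restrict_mem measurableSet_Ioc] with s hs
    have hbeta := integral_beta_interval hα' hα hs.1
    rw [hHeq s hs.1]
    refine (intervalIntegral.norm_integral_le_of_norm_le hs.1.le (Eventually.of_forall
      (hdom s C hs.1 fun r hr => h r ⟨hr.1, hr.2.trans hs.2⟩)) (hbeta.1.const_mul C)).trans ?_
    rw [intervalIntegral.integral_const_mul, hbeta.2]
    simp
  have hHI : ∀ t, 0 < t →
      ∫ s in (0:ℝ)..t, H s = -(ProbabilityTheory.beta (1 - α) α * ∫ s in (0:ℝ)..t, h s) :=
    fun t ht => by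
      have h1 := integral_rpow_integral_rpow one_pos hα' (by linarith) ht (hφint t ht)
      have h2 := integral_rpow_integral_rpow hα' one_pos (by linarith) ht (hφint t ht)
      have h3 := integral_rpow_integral_rpow hα' hα (by linarith) ht
        (hh.integrableOn_Ioc (a := 0) (b := t) (μ := volume))
      have hbeta : ProbabilityTheory.beta 1 (1 - α) = ProbabilityTheory.beta (1 - α) 1 := by
        simp [ProbabilityTheory.beta, add_comm, mul_comm]
      rw [add_comm 1 (1 - α), hbeta, ← h2] at h1
      simp only [sub_self, Real.rpow_zero, one_mul, sub_add_cancel] at h1 h3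
      rw [← h3, ← intervalIntegral.integral_neg]
      have e1 : ∫ s in (0:ℝ)..t, H s
          = ∫ s in (0:ℝ)..t, ∫ r in (0:ℝ)..s, (s - r) ^ (1 - α - 1) * φ r := by
        rw [intervalIntegral.integral_of_le ht.le, intervalIntegral.integral_of_le ht.le]
        exact setIntegral_congr_fun measurableSet_Ioc fun s hs => hHeq s hs.1
      rw [e1, h1, intervalIntegral.integral_of_le ht.le, intervalIntegral.integral_of_le ht.le]
      refine setIntegral_congr_fun measurableSet_Ioc fun s hs => ?_
      rw [hFTC s hs.1, hEeq s hs.1.le, fracInt_eq_integral h hs.1]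
      ring
  have hHval : H t = -(ProbabilityTheory.beta (1 - α) α * h t) := by
    have hmeas : StronglyMeasurableAtFilter H (𝓝 t) := by
      refine ContinuousOn.stronglyMeasurableAtFilter isOpen_Ioi
        (fun s hs => (hHc s hs).continuousWithinAt) t ht
    have d1 := intervalIntegral.integral_hasDerivAt_right (hHint t ht) hmeas (hHc t ht)
    have d2 := ((intervalIntegral.integral_hasDerivAt_right (hh.intervalIntegrable 0 t)
      hh.stronglyMeasurable.stronglyMeasurableAtFilter hh.continuousAt).const_mul
        (ProbabilityTheory.beta (1 - α) α)).neg
    refine d1.unique (d2.congr_of_eventuallyEq ?_)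
    filter_upwards [Ioi_mem_nhds ht] with s hs using hHI s hs
  have hcongr : ∀ s ∈ Ioc 0 t, (t - s) ^ (1 - α - 1) * φ s = deriv E s * (t - s) ^ (-α) :=
    fun s hs => by rw [(hder s hs.1).deriv, hneg, mul_comm]
  constructor
  · obtain ⟨C, hC, h⟩ := hb t
    have hbeta := (integral_beta_interval hα' hα ht).1.const_mul C
    rw [intervalIntegrable_iff_integrableOn_Ioc_of_le ht.le] at hbeta
    have h1 : IntegrableOn (fun s => (t - s) ^ (1 - α - 1) * φ s) (Ioc 0 t) := by
      refine Integrable.mono' hbeta (Measurable.aestronglyMeasurable (by fun_prop)) ?_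
      filter_upwards [ae_restrict_mem measurableSet_Ioc] with s hs using hdom t C ht h s hs
    exact h1.congr_fun hcongr measurableSet_Ioc
  · rw [← hHval, hHeq t ht, intervalIntegral.integral_of_le ht.le,
      intervalIntegral.integral_of_le ht.le]
    exact (setIntegral_congr_fun measurableSet_Ioc hcongr).symm

lemma sub_mul_weight_le_integral {w w' K K' : ℝ → ℝ} {a b : ℝ} (hab : a < b)
    (hw : ContinuousOn w (Icc a b)) (hd : ∀ s ∈ Ioo a b, HasDerivAt w (w' s) s)
    (hKc : ContinuousOn K (Ico a b)) (hK : ∀ s ∈ Ioo a b, HasDerivAt K (K' s) s)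
    (hK' : ∀ s ∈ Ioo a b, 0 ≤ K' s) (hmax : ∀ s ∈ Icc a b, w s ≤ w b)
    (hlim : Tendsto (fun s => (w s - w b) * K s) (𝓝[<] b) (𝓝 0))
    (hint : IntegrableOn (fun s => w' s * K s) (Ioc a b)) :
    (w b - w a) * K a ≤ ∫ s in a..b, w' s * K s := by
  have hcont : ContinuousOn (fun s => (w s - w b) * K s) (Icc a b) := by
    intro s hs
    rcases hs.2.lt_or_eq with h | rfl
    · have h1 : ContinuousWithinAt (fun s => (w s - w b) * K s) (Ico a b) s :=
        (((hw.mono Ico_subset_Icc_self).sub continuousOn_const).mul hKc) s ⟨hs.1, h⟩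
      refine h1.mono_of_mem_nhdsWithin ?_
      filter_upwards [self_mem_nhdsWithin, mem_nhdsWithin_of_mem_nhds (Iio_mem_nhds h)] with x hx hx'
        using ⟨hx.1, hx'⟩
    · rw [← Ico_insert_right hab.le, continuousWithinAt_insert_self, ContinuousWithinAt,
        sub_self, zero_mul]
      exact hlim.mono_left (nhdsWithin_mono _ fun x hx => hx.2)
  have h := intervalIntegral.sub_le_integral_of_hasDeriv_right_of_le hab.le hcont
    (fun s hs => (((hd s hs).sub_const (w b)).mul (hK s hs)).hasDerivWithinAt)
    ((integrableOn_Icc_iff_integrableOn_Ioc).2 hint) (fun s hs => by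
      have := mul_nonneg (sub_nonneg.2 (hmax s (Ioo_subset_Icc_self hs))) (hK' s hs)
      linarith)
  simp only [sub_self, zero_mul, zero_sub] at h
  linarith

lemma tendsto_sub_mul_rpow_neg {α : ℝ} (hα1 : α < 1) {w : ℝ → ℝ} {b c : ℝ}
    (hd : HasDerivAt w c b) :
    Tendsto (fun s => (w s - w b) * (b - s) ^ (-α)) (𝓝[<] b) (𝓝 0) := by
  have h1 : (fun s => (w s - w b) * (b - s) ^ (-α)) =O[𝓝[<] b]
      fun s => (s - b) * (b - s) ^ (-α) :=
    (hd.isBigO_sub.mono nhdsWithin_le_nhds).mul (Asymptotics.isBigO_refl _ _)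
  refine h1.trans_tendsto ?_
  have h2 : Tendsto (fun s : ℝ => -(b - s) ^ (1 - α)) (𝓝[<] b) (𝓝 0) := by
    have : ContinuousAt (fun s : ℝ => -(b - s) ^ (1 - α)) b :=
      ((by fun_prop : Continuous fun s : ℝ => b - s).continuousAt.rpow_const
        (Or.inr (by linarith))).neg
    have h := this.tendsto.mono_left (nhdsWithin_le_nhds (s := Iio b))
    simpa [Real.zero_rpow (by linarith : 1 - α ≠ 0)] using h
  refine h2.congr' ?_
  filter_upwards [self_mem_nhdsWithin] with s hs
  have : 0 < b - s := sub_pos.2 hs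
  rw [show 1 - α = -α + 1 by ring, Real.rpow_add_one this.ne']
  ring

lemma hasDerivAt_sub_rpow_neg {α b s : ℝ} (hs : s < b) :
    HasDerivAt (fun s => (b - s) ^ (-α)) (α * (b - s) ^ (-α - 1)) s := by
  have h := ((hasDerivAt_id s).const_sub b).rpow_const (p := -α) (Or.inl (sub_pos.2 hs).ne')
  convert! h using 1
  simp

/-- Extremum principle for the (unnormalized) Caputo derivative based at `a`: a lower bound at a
maximum point. -/
theorem sub_mul_rpow_le_integral_of_max {α : ℝ} (hα : 0 < α) (hα1 : α < 1) {w w' : ℝ → ℝ}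
    {a b : ℝ} (hab : a < b) (hw : ContinuousOn w (Icc a b))
    (hd : ∀ s ∈ Ioc a b, HasDerivAt w (w' s) s) (hmax : ∀ s ∈ Icc a b, w s ≤ w b)
    (hint : IntegrableOn (fun s => w' s * (b - s) ^ (-α)) (Ioc a b)) :
    (w b - w a) * (b - a) ^ (-α) ≤ ∫ s in a..b, w' s * (b - s) ^ (-α) := by
  refine sub_mul_weight_le_integral hab hw (fun s hs => hd s (Ioo_subset_Ioc_self hs))
    (K := fun s => (b - s) ^ (-α)) (fun s hs =>
      (hasDerivAt_sub_rpow_neg hs.2).continuousAt.continuousWithinAt)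
    (fun s hs => hasDerivAt_sub_rpow_neg hs.2) (fun s hs => ?_) hmax
    (tendsto_sub_mul_rpow_neg hα1 (hd b ⟨hab, le_rfl⟩)) hint
  exact mul_nonneg hα.le (Real.rpow_nonneg (sub_nonneg.2 hs.2.le) _)

/-- If `w` attains its maximum over `[0, t₁]` at `t₁` and its minimum over `[t₁, t₂]` at `t₂`,
then its Caputo derivative at `t₂` does not exceed the one at `t₁`. -/
theorem integral_caputo_le_of_max_of_min {α : ℝ} (hα : 0 < α) (hα1 : α < 1) {w w' : ℝ → ℝ}
    {t₁ t₂ : ℝ} (h0 : 0 < t₁) (h12 : t₁ < t₂) (hw : ContinuousOn w (Icc 0 t₂))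
    (hd : ∀ s ∈ Ioc 0 t₂, HasDerivAt w (w' s) s) (hmax : ∀ s ∈ Icc 0 t₁, w s ≤ w t₁)
    (hmin : ∀ s ∈ Icc t₁ t₂, w t₂ ≤ w s)
    (hint₁ : IntegrableOn (fun s => w' s * (t₁ - s) ^ (-α)) (Ioc 0 t₁))
    (hint₂ : IntegrableOn (fun s => w' s * (t₂ - s) ^ (-α)) (Ioc 0 t₂)) :
    ∫ s in (0:ℝ)..t₂, w' s * (t₂ - s) ^ (-α) ≤ ∫ s in (0:ℝ)..t₁, w' s * (t₁ - s) ^ (-α) := by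
  have hi₁ : IntegrableOn (fun s => w' s * (t₂ - s) ^ (-α)) (Ioc 0 t₁) :=
    hint₂.mono_set (Ioc_subset_Ioc_right h12.le)
  have hi₂ : IntegrableOn (fun s => w' s * (t₂ - s) ^ (-α)) (Ioc t₁ t₂) :=
    hint₂.mono_set (Ioc_subset_Ioc_left h0.le)
  have hI₁ : IntervalIntegrable (fun s => w' s * (t₂ - s) ^ (-α)) volume 0 t₁ :=
    (intervalIntegrable_iff_integrableOn_Ioc_of_le h0.le).2 hi₁
  have hI₂ : IntervalIntegrable (fun s => w' s * (t₂ - s) ^ (-α)) volume t₁ t₂ :=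
    (intervalIntegrable_iff_integrableOn_Ioc_of_le h12.le).2 hi₂
  have hI : IntervalIntegrable (fun s => w' s * (t₁ - s) ^ (-α)) volume 0 t₁ :=
    (intervalIntegrable_iff_integrableOn_Ioc_of_le h0.le).2 hint₁
  have hright : ∫ s in t₁..t₂, w' s * (t₂ - s) ^ (-α) ≤ 0 := by
    have h := sub_mul_rpow_le_integral_of_max hα hα1 (w := fun s => -w s) (w' := fun s => -w' s)
      h12 (hw.mono (Icc_subset_Icc_left h0.le)).neg
      (fun s hs => (hd s ⟨h0.trans hs.1, hs.2⟩).neg) (fun s hs => neg_le_neg (hmin s hs))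
      (by simp only [neg_mul]; exact hi₂.neg)
    simp only [neg_mul, intervalIntegral.integral_neg] at h
    have h1 := mul_nonneg (sub_nonneg.2 (hmin t₁ ⟨le_rfl, h12.le⟩))
      (Real.rpow_nonneg (sub_nonneg.2 h12.le) (-α))
    linarith
  have hpow : ∀ s < t₁, ∀ β ≤ (0:ℝ), (t₂ - s) ^ β ≤ (t₁ - s) ^ β := fun s hs β hβ =>
    Real.rpow_le_rpow_of_nonpos (sub_pos.2 hs) (by linarith) hβ
  have hleft : 0 ≤ ∫ s in (0:ℝ)..t₁, w' s * ((t₁ - s) ^ (-α) - (t₂ - s) ^ (-α)) := by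
    have h := sub_mul_weight_le_integral h0 (hw.mono (Icc_subset_Icc_right h12.le))
      (fun s hs => hd s ⟨hs.1, (hs.2.trans h12).le⟩)
      (K := fun s => (t₁ - s) ^ (-α) - (t₂ - s) ^ (-α))
      (fun s hs => ((hasDerivAt_sub_rpow_neg hs.2).sub
        (hasDerivAt_sub_rpow_neg (hs.2.trans h12))).continuousAt.continuousWithinAt)
      (fun s hs => (hasDerivAt_sub_rpow_neg hs.2).sub (hasDerivAt_sub_rpow_neg (hs.2.trans h12)))
      (fun s hs => by
        rw [← mul_sub]
        exact mul_nonneg hα.le (sub_nonneg.2 (hpow s hs.2 _ (by linarith)))) hmax ?_ ?_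
    · refine le_trans (mul_nonneg (sub_nonneg.2 (hmax 0 ⟨le_rfl, h0.le⟩)) ?_) h
      exact sub_nonneg.2 (hpow 0 h0 _ (by linarith))
    · have hdt := hd t₁ ⟨h0, h12.le⟩
      have l1 := tendsto_sub_mul_rpow_neg hα1 hdt
      have l2 : Tendsto (fun s => (w s - w t₁) * (t₂ - s) ^ (-α)) (𝓝[<] t₁) (𝓝 0) := by
        have : ContinuousAt (fun s => (w s - w t₁) * (t₂ - s) ^ (-α)) t₁ :=
          (hdt.continuousAt.sub continuousAt_const).mul (hasDerivAt_sub_rpow_neg h12).continuousAt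
        simpa using this.tendsto.mono_left (nhdsWithin_le_nhds (s := Iio t₁))
      simpa only [mul_sub, sub_zero] using l1.sub l2
    · simp only [mul_sub]; exact hint₁.sub hi₁
  simp only [mul_sub] at hleft
  rw [intervalIntegral.integral_sub hI hI₁] at hleft
  rw [← intervalIntegral.integral_add_adjacent_intervals hI₁ hI₂]
  linarith

namespace IsCaputoODESolution

variable {α A k : ℝ} {E F : ℝ → ℝ}

lemma hasDerivAt (h : IsCaputoODESolution α A k E) {t : ℝ} (ht : 0 < t) :
    HasDerivAt E (deriv E t) t :=
  ((h.2.1.differentiableOn one_ne_zero).differentiableAt (Ioi_mem_nhds ht)).hasDerivAt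

lemma integral_eq (h : IsCaputoODESolution α A k E) (hα1 : α < 1) {t : ℝ} (ht : 0 < t) :
    ∫ s in (0:ℝ)..t, deriv E s * (t - s) ^ (-α) = -(Real.Gamma (1 - α) * A * E t ^ k) := by
  have h1 := (h.2.2.2.2 t ht).2
  have hG := (Real.Gamma_pos_of_pos (sub_pos.2 hα1)).ne'
  field_simp at h1
  linarith

lemma le_one (h : IsCaputoODESolution α A k E) (hα : 0 < α) (hα1 : α < 1) (hA : 0 < A)
    {t : ℝ} (ht : 0 ≤ t) : E t ≤ 1 := by
  by_contra! hlt
  have hc : ContinuousOn E (Icc 0 t) := h.1.mono Icc_subset_Ici_self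
  obtain ⟨t₀, ht₀, hmax⟩ := isCompact_Icc.exists_isMaxOn (nonempty_Icc.2 ht) hc
  have h1 : 1 < E t₀ := hlt.trans_le (hmax ⟨ht, le_rfl⟩)
  have hpos : 0 < t₀ := by
    refine ht₀.1.lt_of_ne' fun h0 => ?_
    rw [h0, h.2.2.2.1] at h1
    exact lt_irrefl _ h1
  have h2 := sub_mul_rpow_le_integral_of_max hα hα1 hpos
    (hc.mono (Icc_subset_Icc_right ht₀.2)) (fun s hs => h.hasDerivAt hs.1)
    (fun s hs => hmax ⟨hs.1, hs.2.trans ht₀.2⟩) (h.2.2.2.2 t₀ hpos).1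
  rw [h.integral_eq hα1 hpos, h.2.2.2.1, sub_zero] at h2
  have h3 := mul_pos (sub_pos.2 h1) (Real.rpow_pos_of_pos hpos (-α))
  have h4 := Real.rpow_pos_of_pos (h.2.2.1 t₀ hpos.le) k
  have h5 := Real.Gamma_pos_of_pos (sub_pos.2 hα1)
  have : 0 < Real.Gamma (1 - α) * A * E t₀ ^ k := by positivity
  linarith

lemma antitoneOn (h : IsCaputoODESolution α A k E) (hα : 0 < α) (hα1 : α < 1) (hA : 0 < A)
    (hk : 0 < k) : AntitoneOn E (Ici 0) := by
  intro a ha b hb hab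
  by_contra! hlt
  have hc : ContinuousOn E (Icc 0 b) := h.1.mono Icc_subset_Ici_self
  obtain ⟨t₁, ht₁, hmin⟩ := isCompact_Icc.exists_isMinOn (nonempty_Icc.2 hb) hc
  have h1 : E t₁ < E b := (isMinOn_iff.1 hmin a ⟨ha, hab⟩).trans_lt hlt
  have hpos : 0 < t₁ := by
    refine ht₁.1.lt_of_ne' fun h0 => ?_
    rw [h0, h.2.2.2.1] at h1
    exact (h.le_one hα hα1 hA hb).not_gt h1
  obtain ⟨t₂, ht₂, hmax⟩ := isCompact_Icc.exists_isMaxOn (nonempty_Icc.2 ht₁.2)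
    (hc.mono (Icc_subset_Icc_left ht₁.1))
  have h2 : E t₁ < E t₂ := h1.trans_le (hmax ⟨ht₁.2, le_rfl⟩)
  have h12 : t₁ < t₂ := ht₂.1.lt_of_ne fun h0 => by rw [h0] at h2; exact lt_irrefl _ h2
  have hpos₂ := hpos.trans h12
  have h3 := integral_caputo_le_of_max_of_min hα hα1 (w := fun s => -E s)
    (w' := fun s => -deriv E s) hpos h12 (hc.mono (Icc_subset_Icc_right ht₂.2)).neg
    (fun s hs => (h.hasDerivAt hs.1).neg)
    (fun s hs => neg_le_neg (hmin ⟨hs.1, hs.2.trans ht₁.2⟩))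
    (fun s hs => neg_le_neg (hmax ⟨hs.1, hs.2.trans ht₂.2⟩))
    (by simp only [neg_mul]; exact (h.2.2.2.2 t₁ hpos).1.neg)
    (by simp only [neg_mul]; exact (h.2.2.2.2 t₂ hpos₂).1.neg)
  simp only [neg_mul, intervalIntegral.integral_neg] at h3
  rw [h.integral_eq hα1 hpos, h.integral_eq hα1 hpos₂, neg_neg, neg_neg] at h3
  have h4 := Real.rpow_lt_rpow (h.2.2.1 t₁ hpos.le).le h2 hk
  have h5 := mul_pos (Real.Gamma_pos_of_pos (sub_pos.2 hα1)) hA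
  exact (mul_lt_mul_of_pos_left h4 h5).not_ge h3

lemma le (hE : IsCaputoODESolution α A k E) (hF : IsCaputoODESolution α A k F)
    (hα : 0 < α) (hα1 : α < 1) (hA : 0 < A) (hk : 0 < k) {t : ℝ} (ht : 0 ≤ t) : E t ≤ F t := by
  by_contra! hlt
  have hc : ContinuousOn (fun s => E s - F s) (Icc 0 t) :=
    (hE.1.sub hF.1).mono Icc_subset_Ici_self
  obtain ⟨t₀, ht₀, hmax⟩ := isCompact_Icc.exists_isMaxOn (nonempty_Icc.2 ht) hc
  have h1 : 0 < E t₀ - F t₀ := (sub_pos.2 hlt).trans_le (hmax ⟨ht, le_rfl⟩)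
  have hpos : 0 < t₀ := by
    refine ht₀.1.lt_of_ne' fun h0 => ?_
    rw [h0, hE.2.2.2.1, hF.2.2.2.1, sub_self] at h1
    exact lt_irrefl _ h1
  have hiE := (hE.2.2.2.2 t₀ hpos).1
  have hiF := (hF.2.2.2.2 t₀ hpos).1
  have h2 := sub_mul_rpow_le_integral_of_max hα hα1 (w := fun s => E s - F s)
    (w' := fun s => deriv E s - deriv F s) hpos
    (hc.mono (Icc_subset_Icc_right ht₀.2)) (fun s hs => (hE.hasDerivAt hs.1).sub (hF.hasDerivAt hs.1))
    (fun s hs => hmax ⟨hs.1, hs.2.trans ht₀.2⟩) (by simp only [sub_mul]; exact hiE.sub hiF)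
  have hsplit : ∀ s, (deriv E s - deriv F s) * (t₀ - s) ^ (-α) =
      deriv E s * (t₀ - s) ^ (-α) - deriv F s * (t₀ - s) ^ (-α) := fun s => sub_mul _ _ _
  simp_rw [hsplit] at h2
  rw [intervalIntegral.integral_sub
      ((intervalIntegrable_iff_integrableOn_Ioc_of_le hpos.le).2 hiE)
      ((intervalIntegrable_iff_integrableOn_Ioc_of_le hpos.le).2 hiF),
    hE.integral_eq hα1 hpos, hF.integral_eq hα1 hpos, hE.2.2.2.1, hF.2.2.2.1, sub_zero] at h2
  have h3 := mul_pos h1 (Real.rpow_pos_of_pos hpos (-α))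
  have h4 := Real.rpow_lt_rpow (hF.2.2.1 t₀ hpos.le).le (sub_pos.1 h1) hk
  have h5 := mul_lt_mul_of_pos_left h4 (mul_pos (Real.Gamma_pos_of_pos (sub_pos.2 hα1)) hA)
  linarith

lemma one_sub_mul_rpow_le (h : IsCaputoODESolution α A k E) (hα : 0 < α) (hα1 : α < 1)
    (hanti : AntitoneOn E (Ici 0)) {t : ℝ} (ht : 0 < t) :
    (1 - E t) * t ^ (-α) ≤ Real.Gamma (1 - α) * A * E t ^ k := by
  have h2 := sub_mul_rpow_le_integral_of_max hα hα1 (w := fun s => -E s)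
    (w' := fun s => -deriv E s) ht (h.1.mono Icc_subset_Ici_self).neg
    (fun s hs => (h.hasDerivAt hs.1).neg)
    (fun s hs => neg_le_neg (hanti hs.1 ht.le hs.2))
    (by simp only [neg_mul]; exact (h.2.2.2.2 t ht).1.neg)
  simp only [neg_mul, intervalIntegral.integral_neg] at h2
  rw [h.integral_eq hα1 ht, h.2.2.2.1, sub_zero] at h2
  linarith

lemma exists_eventually_lower_bound (h : IsCaputoODESolution α A k E) (hα : 0 < α) (hα1 : α < 1)
    (hA : 0 < A) (hk : 0 < k) (hanti : AntitoneOn E (Ici 0)) (hlim : Tendsto E atTop (𝓝 0)) :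
    ∃ C : ℝ, 0 < C ∧ ∀ᶠ t : ℝ in atTop, C * t ^ (-(α / k)) ≤ E t := by
  have hG := Real.Gamma_pos_of_pos (sub_pos.2 hα1)
  refine ⟨(1 / (2 * (Real.Gamma (1 - α) * A))) ^ (1 / k), by positivity, ?_⟩
  filter_upwards [eventually_gt_atTop 0,
    hlim.eventually (ge_mem_nhds (show (0:ℝ) < 1 / 2 by norm_num))] with t ht hhalf
  have h1 := h.one_sub_mul_rpow_le hα hα1 hanti ht
  have hp := Real.rpow_pos_of_pos ht (-α)
  have hEt := h.2.2.1 t ht.le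
  have h2 : 1 / (2 * (Real.Gamma (1 - α) * A)) * t ^ (-α) ≤ E t ^ k := by
    rw [div_mul_eq_mul_div, one_mul, div_le_iff₀ (by positivity)]
    nlinarith
  have h3 := Real.rpow_le_rpow (by positivity) h2 (by positivity : 0 ≤ 1 / k)
  rw [Real.mul_rpow (by positivity) hp.le, ← Real.rpow_mul ht.le, ← Real.rpow_mul hEt.le,
    mul_one_div_cancel hk.ne', Real.rpow_one] at h3
  rwa [show -(α / k) = -α * (1 / k) by ring]

end IsCaputoODESolution

lemma exists_abs_sub_sub_mul_le_of_uniformContinuous {f f' : ℝ → ℝ}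
    (hf : ∀ x, HasDerivAt f (f' x) x) (hf' : UniformContinuous f') {ε : ℝ} (hε : 0 < ε) :
    ∃ δ > 0, ∀ x y, |x - y| < δ → |f x - f y - f' y * (x - y)| ≤ ε * |x - y| := by
  obtain ⟨δ, hδ, h⟩ := Metric.uniformContinuous_iff.1 hf' ε hε
  refine ⟨δ, hδ, fun x y hxy => ?_⟩
  have h1 := (convex_uIcc y x).norm_image_sub_le_of_norm_hasDerivWithin_le
    (f := fun z => f z - f' y * z) (f' := fun z => f' z - f' y * 1) (C := ε)
    (fun z _ => ((hf z).sub ((hasDerivAt_id z).const_mul (f' y))).hasDerivWithinAt)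
    (fun z hz => by
      have hzy : dist z y < δ := (abs_sub_left_of_mem_uIcc hz).trans_lt hxy
      simpa [Real.dist_eq] using (h hzy).le) left_mem_uIcc right_mem_uIcc
  rw [Real.norm_eq_abs, Real.norm_eq_abs] at h1
  convert h1 using 2
  ring

/-- A globally Lipschitz, nondecreasing `C¹` function with uniformly continuous derivative that
agrees with `κ x ^ k` on `[0, 1]`. -/
lemma exists_monotone_extension_const_mul_rpow {κ k : ℝ} (hκ : 0 < κ) (hk : 1 ≤ k) :
    ∃ f f' : ℝ → ℝ, (∀ x, HasDerivAt f (f' x) x) ∧ UniformContinuous f' ∧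
      (∀ x, |f' x| ≤ κ * k) ∧ Monotone f ∧ ∀ x ∈ Icc (0:ℝ) 1, f x = κ * x ^ k := by
  have hcont : Continuous fun r : Icc (0:ℝ) 1 => κ * k * (r : ℝ) ^ (k - 1) :=
    continuous_const.mul ((Real.continuous_rpow_const (by linarith)).comp continuous_subtype_val)
  have hunif := (CompactSpace.uniformContinuous_of_continuous hcont).comp
    (LipschitzWith.projIcc (zero_le_one' ℝ)).uniformContinuous
  set f' : ℝ → ℝ := (fun r : Icc (0:ℝ) 1 => κ * k * (r : ℝ) ^ (k - 1)) ∘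
    projIcc 0 1 (zero_le_one' ℝ) with hf'
  have hnonneg : ∀ x, 0 ≤ f' x := fun x => by
    have := Real.rpow_nonneg (projIcc 0 1 (zero_le_one' ℝ) x).2.1 (k - 1)
    simp only [hf', Function.comp_apply]
    positivity
  have hderiv : ∀ x, HasDerivAt (fun x => ∫ y in (0:ℝ)..x, f' y) (f' x) x := fun x =>
    hunif.continuous.integral_hasStrictDerivAt 0 x |>.hasDerivAt
  refine ⟨_, f', hderiv, hunif, fun x => ?_, ?_, fun x hx => ?_⟩
  · rw [abs_of_nonneg (hnonneg x)]
    exact mul_le_of_le_one_right (by positivity)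
      (Real.rpow_le_one (projIcc 0 1 (zero_le_one' ℝ) x).2.1
        (projIcc 0 1 (zero_le_one' ℝ) x).2.2 (by linarith))
  · exact monotone_of_hasDerivAt_nonneg hderiv hnonneg
  · have h1 : ∫ y in (0:ℝ)..x, f' y = ∫ y in (0:ℝ)..x, κ * k * y ^ (k - 1) := by
      refine integral_congr fun y hy => ?_
      rw [uIcc_of_le hx.1] at hy
      simp only [hf', Function.comp_apply, projIcc_of_mem _ (⟨hy.1, hy.2.trans hx.2⟩ : y ∈ Icc 0 1)]
    simp only [h1]
    rw [intervalIntegral.integral_const_mul, integral_rpow (Or.inl (by linarith)),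
      sub_add_cancel, Real.zero_rpow (by linarith), sub_zero]
    field_simp

/-- Existence, together with the associated Volterra equation. -/
theorem exists_isCaputoODESolution {α A k : ℝ} (hα : 0 < α) (hα1 : α < 1) (hA : 0 < A)
    (hk : 1 ≤ k) :
    ∃ E h : ℝ → ℝ, IsCaputoODESolution α A k E ∧ Continuous h ∧
      (∀ t, 0 ≤ t → E t = 1 - fracInt α h t) ∧
      ∀ t, 0 ≤ t → h t = A / Real.Gamma α * E t ^ k := by
  have hG := Real.Gamma_pos_of_pos hα
  have hG' := Real.Gamma_pos_of_pos (sub_pos.2 hα1)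
  have hbeta : ProbabilityTheory.beta (1 - α) α = Real.Gamma (1 - α) * Real.Gamma α := by
    simp [ProbabilityTheory.beta]
  have hB : 0 < ProbabilityTheory.beta (1 - α) α := by rw [hbeta]; positivity
  obtain ⟨f, f', hf, hf'u, hf'L, hmono, hfeq⟩ :=
    exists_monotone_extension_const_mul_rpow (div_pos hA hG) hk
  have hfc : Continuous f := continuous_iff_continuousAt.2 fun x => (hf x).continuousAt
  have hf0 : f 0 = 0 := by
    rw [hfeq 0 ⟨le_rfl, zero_le_one⟩, Real.zero_rpow (by linarith), mul_zero]
  obtain ⟨E, v, hE, hv, hEeq, hder, hvb⟩ := exists_differentiable_volterra_solution hα hfc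
    hf'u.continuous hf'L
    (fun x y => convex_univ.norm_image_sub_le_of_norm_hasDerivWithin_le
      (fun z _ => (hf z).hasDerivWithinAt) (fun z _ => hf'L z) (mem_univ y) (mem_univ x))
    (fun ε hε => exists_abs_sub_sub_mul_le_of_uniformContinuous hf hf'u hε) hf0
  have hh : Continuous fun s => f (E s) := hfc.comp hE
  have hcap := fun {t : ℝ} (ht : 0 < t) => caputo_of_volterra hα hα1 hE hv hh hEeq hder hvb ht
  have hder' : ∀ t, 0 < t → HasDerivAt E (deriv E t) t := fun t ht =>
    (hder t ht).differentiableAt.hasDerivAt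
  have hE0 : E 0 = 1 := by
    rw [hEeq 0 le_rfl, fracInt, Real.zero_rpow hα.ne', zero_mul, sub_zero]
  have hle : ∀ t, 0 ≤ t → E t ≤ 1 := by
    intro t ht
    by_contra! hlt
    obtain ⟨t₀, ht₀, hmax⟩ := isCompact_Icc.exists_isMaxOn (nonempty_Icc.2 ht) hE.continuousOn
    have h1 : 1 < E t₀ := hlt.trans_le (hmax ⟨ht, le_rfl⟩)
    have hpos : 0 < t₀ := by
      refine ht₀.1.lt_of_ne' fun h0 => ?_
      rw [h0, hE0] at h1
      exact lt_irrefl _ h1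
    have h2 := sub_mul_rpow_le_integral_of_max hα hα1 hpos hE.continuousOn
      (fun s hs => hder' s hs.1) (fun s hs => hmax ⟨hs.1, hs.2.trans ht₀.2⟩) (hcap hpos).1
    rw [(hcap hpos).2, hE0] at h2
    have h3 := mul_pos (sub_pos.2 h1) (Real.rpow_pos_of_pos hpos (-α))
    have h4 : 0 ≤ f (E t₀) := hf0 ▸ hmono (by linarith)
    rw [sub_zero] at h2
    linarith [mul_nonneg hB.le h4]
  have hpos : ∀ t, 0 ≤ t → 0 < E t := by
    intro t ht
    by_contra! hlt
    obtain ⟨t₀, ht₀, hmin⟩ := isCompact_Icc.exists_isMinOn (nonempty_Icc.2 ht) hE.continuousOn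
    have h1 : E t₀ ≤ 0 := (isMinOn_iff.1 hmin t ⟨ht, le_rfl⟩).trans hlt
    have hpos : 0 < t₀ := by
      refine ht₀.1.lt_of_ne' fun h0 => ?_
      rw [h0, hE0] at h1
      linarith
    have h2 := sub_mul_rpow_le_integral_of_max hα hα1 (w := fun s => -E s)
      (w' := fun s => -deriv E s) hpos hE.continuousOn.neg
      (fun s hs => (hder' s hs.1).neg)
      (fun s hs => neg_le_neg (hmin ⟨hs.1, hs.2.trans ht₀.2⟩))
      (by simp only [neg_mul]; exact (hcap hpos).1.neg)
    simp only [neg_mul, intervalIntegral.integral_neg] at h2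
    rw [(hcap hpos).2, hE0, sub_zero] at h2
    have h3 : 0 < (-E t₀ - -1) * t₀ ^ (-α) :=
      mul_pos (by linarith) (Real.rpow_pos_of_pos hpos (-α))
    have h4 : f (E t₀) ≤ 0 := hf0 ▸ hmono h1
    linarith [mul_nonpos_of_nonneg_of_nonpos hB.le h4]
  have hfE : ∀ t, 0 ≤ t → f (E t) = A / Real.Gamma α * E t ^ k := fun t ht =>
    hfeq _ ⟨(hpos t ht).le, hle t ht⟩
  refine ⟨E, fun s => f (E s), ⟨hE.continuousOn, ?_, hpos, hE0, fun t ht => ⟨(hcap ht).1, ?_⟩⟩,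
    hh, hEeq, hfE⟩
  · refine (contDiffOn_one_iff_derivWithin (uniqueDiffOn_Ioi 0)).2
      ⟨fun t ht => (hder t ht).differentiableAt.differentiableWithinAt, ?_⟩
    have hc : ContinuousOn (fun t => v t / t) (Ioi 0) :=
      hv.continuousOn.div continuousOn_id fun t ht => (mem_Ioi.1 ht).ne'
    exact hc.congr fun t ht =>
      (hder t ht).hasDerivWithinAt.derivWithin (uniqueDiffOn_Ioi 0 t ht)
  · rw [(hcap ht).2, hfE t ht.le, hbeta]
    field_simp
    ring

/-- An antitone solution of the Volterra equation with kernel `κ (t - s) ^ (α - 1)` decays at least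
like `t ^ (-(α / k))`. -/
lemma le_mul_rpow_of_volterra {α κ k : ℝ} (hα : 0 < α) (hκ : 0 < κ) (hk : 0 < k) {E h : ℝ → ℝ}
    (hh : Continuous h) (hEeq : ∀ t, 0 ≤ t → E t = 1 - fracInt α h t)
    (hhE : ∀ t, 0 ≤ t → h t = κ * E t ^ k) (hpos : ∀ t, 0 ≤ t → 0 < E t)
    (hanti : AntitoneOn E (Ici 0)) {t : ℝ} (ht : 0 < t) :
    E t ≤ (α / κ) ^ (1 / k) * t ^ (-(α / k)) := by
  have hEt := hpos t ht.le
  have h1 : fracInt α (fun _ => κ * E t ^ k) t ≤ fracInt α h t :=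
    fracInt_mono hα continuous_const hh ht.le fun s hs => by
      rw [hhE s hs.1]
      exact mul_le_mul_of_nonneg_left
        (Real.rpow_le_rpow hEt.le (hanti hs.1 ht.le hs.2) hk.le) hκ.le
  rw [fracInt_const hα] at h1
  have hp := Real.rpow_pos_of_pos ht α
  have h2 : t ^ α * (κ * E t ^ k) / α ≤ 1 := by linarith [hEeq t ht.le]
  have h3 : E t ^ k ≤ α / κ * t ^ (-α) := by
    rw [div_le_one hα] at h2
    rw [Real.rpow_neg ht.le, ← div_eq_mul_inv, div_div, le_div_iff₀ (by positivity)]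
    linarith
  have h4 := Real.rpow_le_rpow (Real.rpow_nonneg hEt.le k) h3 (by positivity : 0 ≤ 1 / k)
  rw [Real.mul_rpow (by positivity) (Real.rpow_nonneg ht.le _), ← Real.rpow_mul ht.le,
    ← Real.rpow_mul hEt.le, mul_one_div_cancel hk.ne', Real.rpow_one] at h4
  rwa [show -(α / k) = -α * (1 / k) by ring]

end

/-- For `0 < α < 1`, `A > 0` and `k ≥ 1` there is a unique solution `E` on
`[0,∞)` of the Caputo ODE `∂_t^α E + A E^k = 0`, `E(0) = 1`; moreover `E` is nonincreasing,
tends to `0` at infinity, and satisfies `C t^{-α/k} ≤ E t` for large `t` and, for every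
`ε ∈ (0, α/k)`, `E t ≤ C_ε t^{-(α/k - ε)}` for large `t`. -/
theorem stmt_8 (α A k : ℝ) (hα0 : 0 < α) (hα1 : α < 1) (hA : 0 < A) (hk : 1 ≤ k) :
    ∃ E : ℝ → ℝ,
      IsCaputoODESolution α A k E ∧
      (∀ F : ℝ → ℝ, IsCaputoODESolution α A k F → Set.EqOn F E (Set.Ici 0)) ∧
      AntitoneOn E (Set.Ici 0) ∧
      Tendsto E atTop (nhds 0) ∧
      (∃ C : ℝ, 0 < C ∧ ∀ᶠ t : ℝ in atTop, C * t ^ (-(α / k)) ≤ E t) ∧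
      (∀ ε : ℝ, 0 < ε → ε < α / k →
        ∃ Cε : ℝ, 0 < Cε ∧ ∀ᶠ t : ℝ in atTop, E t ≤ Cε * t ^ (-(α / k - ε))) := by
  have hk0 : 0 < k := by linarith
  obtain ⟨E, h, hE, hh, hEeq, hhE⟩ := exists_isCaputoODESolution hα0 hα1 hA hk
  have hanti := hE.antitoneOn hα0 hα1 hA hk0
  have hκ : 0 < A / Real.Gamma α := div_pos hA (Real.Gamma_pos_of_pos hα0)
  have hupper : ∀ t, 0 < t → E t ≤ (α / (A / Real.Gamma α)) ^ (1 / k) * t ^ (-(α / k)) :=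
    fun t ht => le_mul_rpow_of_volterra hα0 hκ hk0 hh hEeq hhE hE.2.2.1 hanti ht
  have hlim : Tendsto E atTop (nhds 0) := by
    have h0 := (tendsto_rpow_neg_atTop (div_pos hα0 hk0)).const_mul
      ((α / (A / Real.Gamma α)) ^ (1 / k))
    rw [mul_zero] at h0
    refine squeeze_zero' ?_ ?_ h0
    · filter_upwards [eventually_ge_atTop 0] with t ht using (hE.2.2.1 t ht).le
    · filter_upwards [eventually_gt_atTop 0] with t ht using hupper t ht
  refine ⟨E, hE, fun F hF t ht => le_antisymm (hF.le hE hα0 hα1 hA hk0 ht)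
    (hE.le hF hα0 hα1 hA hk0 ht), hanti, hlim,
    hE.exists_eventually_lower_bound hα0 hα1 hA hk0 hanti hlim, fun ε hε _ =>
    ⟨(α / (A / Real.Gamma α)) ^ (1 / k), by positivity, ?_⟩⟩
  filter_upwards [eventually_ge_atTop 1] with t ht
  refine (hupper t (by linarith)).trans (mul_le_mul_of_nonneg_left ?_ (by positivity))
  exact Real.rpow_le_rpow_of_exponent_le ht (by linarith)
end
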